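/- arXiv:1309.1970 — 2 statements merged into one kernel-verified Lean document; each statement's English description precedes it below -/
import Mathlib

section
/- Let n ≥ 2, U ⊆ ℝ^m, and let u ↦ H(u) assign to each u ∈ U an n×n complex Hermitian matrix, depending smoothly on u. Then the lifted control system i·ġ(t) = H(u(t))·g(t) on the unitary group U(n) is approximately controllable (every reachable set is dense in U(n)) if and only if it is exactly controllable (every reachable set equals U(n)). -/
attribute [local instance] Matrix.normedAddCommGroup Matrix.normedSpace

open MeasureTheory in
/-- A control `u : [0,T] → U` which is measurable and (essentially) bounded. -/
def IsAdmissibleControl {m : ℕ} (U : Set (EuclideanSpace ℝ (Fin m))) (T : ℝ)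
    (u : ℝ → EuclideanSpace ℝ (Fin m)) : Prop :=
  AEStronglyMeasurable u (volume.restrict (Set.Icc 0 T)) ∧
  (∀ t ∈ Set.Icc 0 T, u t ∈ U) ∧ ∃ C : ℝ, ∀ t ∈ Set.Icc 0 T, ‖u t‖ ≤ C

/-- An admissible trajectory of the lifted system `i·ġ(t) = H(u(t))·g(t)` on the
unitary group: an absolutely continuous curve in `U(n)` solving the equation almost
everywhere on `[0,T]`, encoded in integral form. -/
def IsLiftedTrajectory {n m : ℕ}
    (Hmat : EuclideanSpace ℝ (Fin m) → Matrix (Fin n) (Fin n) ℂ) (T : ℝ)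
    (u : ℝ → EuclideanSpace ℝ (Fin m)) (g : ℝ → Matrix (Fin n) (Fin n) ℂ) : Prop :=
  (∀ t ∈ Set.Icc 0 T, g t ∈ Matrix.unitaryGroup (Fin n) ℂ) ∧
  @IntervalIntegrable (Matrix (Fin n) (Fin n) ℂ) _ NormedAddGroup.toENormedAddMonoid
    (fun s => (-Complex.I) • (Hmat (u s) * g s))
    MeasureTheory.volume 0 T ∧
  ∀ t ∈ Set.Icc 0 T, g t = g 0 + ∫ s in (0:ℝ)..t, (-Complex.I) • (Hmat (u s) * g s)

/-- The reachable set from `g0` of the lifted system on the unitary group. -/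
def liftedReachable {n m : ℕ} (U : Set (EuclideanSpace ℝ (Fin m)))
    (Hmat : EuclideanSpace ℝ (Fin m) → Matrix (Fin n) (Fin n) ℂ)
    (g0 : Matrix (Fin n) (Fin n) ℂ) : Set (Matrix (Fin n) (Fin n) ℂ) :=
  {g1 | ∃ T : ℝ, 0 ≤ T ∧ ∃ u g, IsAdmissibleControl U T u ∧
    IsLiftedTrajectory Hmat T u g ∧ g 0 = g0 ∧ g T = g1}

/-- An admissible trajectory of the system `i·ψ̇(t) = H(u(t))·ψ(t)` on the unit sphere
of `ℂ^n`: an absolutely continuous curve in the sphere solving the equation almost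
everywhere on `[0,T]`, encoded in integral form. -/
def IsSphereTrajectory {n m : ℕ}
    (Hmat : EuclideanSpace ℝ (Fin m) → Matrix (Fin n) (Fin n) ℂ) (T : ℝ)
    (u : ℝ → EuclideanSpace ℝ (Fin m)) (ψ : ℝ → EuclideanSpace ℂ (Fin n)) : Prop :=
  (∀ t ∈ Set.Icc 0 T, ψ t ∈ Metric.sphere (0 : EuclideanSpace ℂ (Fin n)) 1) ∧
  IntervalIntegrable (fun s => (-Complex.I) • Matrix.toEuclideanLin (Hmat (u s)) (ψ s))
    MeasureTheory.volume 0 T ∧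
  ∀ t ∈ Set.Icc 0 T,
    ψ t = ψ 0 + ∫ s in (0:ℝ)..t, (-Complex.I) • Matrix.toEuclideanLin (Hmat (u s)) (ψ s)

/-- The reachable set from `ψ0` of the system on the unit sphere of `ℂ^n`. -/
def sphereReachable {n m : ℕ} (U : Set (EuclideanSpace ℝ (Fin m)))
    (Hmat : EuclideanSpace ℝ (Fin m) → Matrix (Fin n) (Fin n) ℂ)
    (ψ0 : EuclideanSpace ℂ (Fin n)) : Set (EuclideanSpace ℂ (Fin n)) :=
  {ψ1 | ∃ T : ℝ, 0 ≤ T ∧ ∃ u ψ, IsAdmissibleControl U T u ∧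
    IsSphereTrajectory Hmat T u ψ ∧ ψ 0 = ψ0 ∧ ψ T = ψ1}


section KrenerAbstract
open Filter Topology

def KrenerGood {𝔸 : Type*} [NormedRing 𝔸] [NormedAlgebra ℝ 𝔸] (S : Set 𝔸)
    (V : Submodule ℝ 𝔸) : Prop :=
  ∃ (E : Type) (_ : NormedAddCommGroup E) (_ : NormedSpace ℝ E) (_ : CompleteSpace E)
    (P : E → 𝔸) (P' : E →L[ℝ] 𝔸), HasStrictFDerivAt P P' 0 ∧ (∀ᶠ t in 𝓝 (0 : E), P t ∈ S) ∧
      ∀ Y ∈ V, ∃ e, P' e = Y * P 0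

theorem krenerGood_bot {𝔸 : Type*} [NormedRing 𝔸] [NormedAlgebra ℝ 𝔸] (S : Set 𝔸) {s : 𝔸}
    (hs : s ∈ S) : KrenerGood S ⊥ := by
  refine ⟨ℝ, inferInstance, inferInstance, inferInstance, fun _ => s, 0,
    hasStrictFDerivAt_const _ _, Eventually.of_forall fun _ => hs, ?_⟩
  intro Y hY
  rw [Submodule.mem_bot] at hY
  exact ⟨0, by simp [hY]⟩

theorem krenerGood_step {𝔸 : Type*} [NormedRing 𝔸] [NormedAlgebra ℝ 𝔸] [CompleteSpace 𝔸]
    [StarRing 𝔸] (S : Set 𝔸) (hSu : S ⊆ unitary 𝔸)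
    (hmul : ∀ x ∈ S, ∀ y ∈ S, x * y ∈ S) (𝒜 : Set 𝔸)
    (hexp : ∀ A ∈ 𝒜, ∀ t : ℝ, 0 ≤ t → NormedSpace.exp (t • A) ∈ S)
    (V : Submodule ℝ 𝔸) (hV : KrenerGood S V)
    (hspan : ∀ h ∈ S, ∃ s ∈ S, ∃ A ∈ 𝒜, (h * s) * A * star (h * s) ∉ V) :
    ∃ V', KrenerGood S V' ∧ V < V' := by
  obtain ⟨E, _, _, _, P, P', hP, hPS, hPV⟩ := hV
  have h0 : P 0 ∈ S := hPS.self_of_nhds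
  obtain ⟨s, hs, A, hA, hnot⟩ := hspan _ h0
  set Z := (P 0 * s) * A * star (P 0 * s) with hZ
  have hu : star (P 0 * s) * (P 0 * s) = 1 :=
    (Unitary.mem_iff.1 (hSu (hmul _ h0 _ hs))).1
  set x : 𝔸 := NormedSpace.exp A with hx
  have hd : HasStrictDerivAt (fun τ : ℝ => NormedSpace.exp ((1 + τ) • A)) (A * x) 0 := by
    have h1 := hasStrictDerivAt_exp_smul_const' (𝕂 := ℝ) A (1 + 0)
    have h2 : HasStrictDerivAt (fun τ : ℝ => 1 + τ) 1 (0:ℝ) :=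
      (hasStrictDerivAt_id (0:ℝ)).const_add 1
    have := HasStrictDerivAt.scomp (0:ℝ) h1 h2
    simpa [Function.comp_def, hx] using this
  have hQ : HasStrictFDerivAt (fun p : E × ℝ => (P p.1 * s) * NormedSpace.exp ((1 + p.2) • A))
      _ (0 : E × ℝ) :=
    ((HasStrictFDerivAt.comp (0 : E × ℝ) (f := Prod.fst) hP hasStrictFDerivAt_fst).mul_const' s).mul'
      (HasStrictFDerivAt.comp (0 : E × ℝ) (f := Prod.snd) hd.hasStrictFDerivAt hasStrictFDerivAt_snd)
  refine ⟨V ⊔ Submodule.span ℝ {Z}, ⟨E × ℝ, inferInstance, inferInstance, inferInstance, _, _, hQ,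
    ?_, ?_⟩, ?_⟩
  · have e1 : ∀ᶠ p : E × ℝ in 𝓝 0, P p.1 ∈ S :=
      (continuous_fst.tendsto (0 : E × ℝ)).eventually hPS
    have e2 : ∀ᶠ p : E × ℝ in 𝓝 0, -1 < p.2 :=
      (continuous_snd.tendsto (0 : E × ℝ)).eventually (lt_mem_nhds (by simp))
    filter_upwards [e1, e2] with p h1 h2
    exact hmul _ (hmul _ h1 _ hs) _ (hexp A hA _ (by linarith))
  · intro Y hY
    obtain ⟨Y1, hY1, Y2, hY2, rfl⟩ := Submodule.mem_sup.1 hY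
    obtain ⟨c, rfl⟩ := Submodule.mem_span_singleton.1 hY2
    obtain ⟨e, he⟩ := hPV _ hY1
    refine ⟨(e, c), ?_⟩
    simp [he, hZ, add_mul, mul_assoc]
    have : star (P 0 * s) * (P 0 * (s * x)) = x := by
      rw [← mul_assoc (P 0), ← mul_assoc, hu, one_mul]
    have h2 : star s * (star (P 0) * (P 0 * (s * x))) = x := by
      rw [star_mul, mul_assoc] at this; exact this
    rw [hx] at h2
    simp [h2, hx, add_comm]
  · refine lt_of_le_of_ne le_sup_left fun h => hnot ?_
    rw [h]
    exact Submodule.mem_sup_right (Submodule.mem_span_singleton_self _)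

theorem krener_final {𝔸 : Type*} [NormedRing 𝔸] [NormedAlgebra ℝ 𝔸] [CompleteSpace 𝔸]
    [StarRing 𝔸] [ContinuousStar 𝔸] [StarModule ℝ 𝔸] (S : Set 𝔸) (hSu : S ⊆ unitary 𝔸)
    (V : Submodule ℝ 𝔸) (hV : KrenerGood S V) (hsk : ∀ Y, star Y = -Y → Y ∈ V) :
    ∃ x ∈ S, ∀ᶠ g in 𝓝 x, g ∈ unitary 𝔸 → g ∈ S := by
  obtain ⟨E, _, _, _, P, P', hP, hPS, hPV⟩ := hV
  have h0 : P 0 ∈ S := hPS.self_of_nhds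
  refine ⟨P 0, h0, ?_⟩
  have hu := Unitary.mem_iff.1 (hSu h0)
  let st : 𝔸 →L[ℝ] 𝔸 := (starL' ℝ : 𝔸 ≃L[ℝ] 𝔸)
  have hst : ∀ X, st X = star X := fun X => rfl
  let K : 𝔸 →L[ℝ] 𝔸 := ContinuousLinearMap.id ℝ 𝔸 + st
  have hK : ∀ X, K X = X + star X := fun X => rfl
  have hQ : HasStrictFDerivAt (fun p : E × 𝔸 => P p.1 * (1 + K p.2)) _ (0 : E × 𝔸) :=
    (HasStrictFDerivAt.comp (0 : E × 𝔸) (f := Prod.fst) hP hasStrictFDerivAt_fst).mul'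
      ((HasStrictFDerivAt.comp (0 : E × 𝔸) (f := Prod.snd) K.hasStrictFDerivAt
        hasStrictFDerivAt_snd).const_add 1)
  have hmap := hQ.map_nhds_eq_of_surj (by
    rw [LinearMap.range_eq_top]
    intro Z
    set B := star (P 0) * Z with hB
    obtain ⟨e, he⟩ := hPV ((2⁻¹ : ℝ) • (P 0 * (B - star B) * star (P 0))) (hsk _ (by
      simp only [star_smul, star_mul, star_sub, star_star, star_trivial, ← smul_neg]
      congr 1
      noncomm_ring))
    refine ⟨(e, (4⁻¹ : ℝ) • (B + star B)), ?_⟩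
    have hZ : Z = P 0 * B := by rw [hB, ← mul_assoc, hu.2, one_mul]
    have hgoal : P 0 * K ((4⁻¹ : ℝ) • (B + star B)) + P' e * (1 + K 0) = Z := by
      rw [map_zero, add_zero, mul_one, he, smul_mul_assoc, mul_assoc, hu.1, mul_one, hZ, hK,
        star_smul, star_add, star_star, star_trivial (4⁻¹ : ℝ), mul_add, mul_smul_comm, mul_smul_comm,
        mul_add, mul_add, mul_sub]
      module
    exact hgoal)
  have e1 : ∀ᶠ p : E × 𝔸 in 𝓝 0, P p.1 ∈ S :=
    (continuous_fst.tendsto (0 : E × 𝔸)).eventually hPS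
  have e2 : ∀ᶠ p : E × 𝔸 in 𝓝 0, IsUnit ((2:𝔸) + K p.2) := by
    have hc : Continuous fun p : E × 𝔸 => (2:𝔸) + K p.2 := by fun_prop
    refine (hc.tendsto 0).eventually (Units.isOpen.mem_nhds ?_)
    have h2 : IsUnit (2 : 𝔸) := by
      have : IsUnit (algebraMap ℝ 𝔸 2) := (IsUnit.mk0 (2:ℝ) two_ne_zero).map _
      rwa [map_ofNat] at this
    simpa using h2
  have e3 := (e1.and e2)
  have hPP : P 0 = P (0 : E × 𝔸).1 * (1 + K (0 : E × 𝔸).2) := by simp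
  rw [hPP, ← hmap, eventually_map]
  filter_upwards [e3] with p hp hg
  obtain ⟨h1, h2⟩ := hp
  have hpu := Unitary.mem_iff.1 (hSu h1)
  have hg' := (Unitary.mem_iff.1 hg).1
  have hKs : star (K p.2) = K p.2 := by simp [hK, add_comm]
  have h3 : (1 + K p.2) * (1 + K p.2) = 1 := by
    rw [star_mul, star_add, star_one, hKs, mul_assoc, ← mul_assoc (star (P p.1)), hpu.1,
      one_mul] at hg'
    exact hg'
  have h4 : (2 + K p.2) * K p.2 = 0 := by
    have : (2 + K p.2) * K p.2 = (1 + K p.2) * (1 + K p.2) - 1 := by noncomm_ring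
    rw [this, h3, sub_self]
  have h5 : K p.2 = 0 := (h2.mul_right_eq_zero).1 h4
  simpa [h5] using h1

theorem krener_abstract {𝔸 : Type*} [NormedRing 𝔸] [NormedAlgebra ℝ 𝔸] [FiniteDimensional ℝ 𝔸]
    [StarRing 𝔸] [ContinuousStar 𝔸] [StarModule ℝ 𝔸] (S : Set 𝔸) (hSu : S ⊆ unitary 𝔸)
    (hne : S.Nonempty)
    (hmul : ∀ x ∈ S, ∀ y ∈ S, x * y ∈ S) (𝒜 : Set 𝔸)
    (hexp : ∀ A ∈ 𝒜, ∀ t : ℝ, 0 ≤ t → NormedSpace.exp (t • A) ∈ S)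
    (hspan : ∀ h ∈ S, ∀ V : Submodule ℝ 𝔸,
      (∀ s ∈ S, ∀ A ∈ 𝒜, (h * s) * A * star (h * s) ∈ V) → ∀ Y, star Y = -Y → Y ∈ V) :
    ∃ x ∈ S, ∀ᶠ g in 𝓝 x, g ∈ unitary 𝔸 → g ∈ S := by
  have : CompleteSpace 𝔸 := FiniteDimensional.complete ℝ 𝔸
  obtain ⟨s, hs⟩ := hne
  obtain ⟨V, hV, hmax⟩ := WellFounded.has_min
    (wellFounded_gt : WellFounded ((· > ·) : Submodule ℝ 𝔸 → Submodule ℝ 𝔸 → Prop))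
    {V | KrenerGood S V} ⟨⊥, krenerGood_bot S hs⟩
  refine krener_final S hSu V hV ?_
  by_contra hcon
  obtain ⟨V', hV', hlt⟩ := krenerGood_step S hSu hmul 𝒜 hexp V hV (by
    intro h hh
    by_contra hc
    push Not at hc
    exact hcon (hspan h hh V hc))
  exact hmax V' hV' hlt

end KrenerAbstract

section AdSpan
open Matrix

theorem adspan_diag {n : ℕ} (W : Submodule ℝ (Matrix (Fin n) (Fin n) ℂ))
    (hW : ∀ g ∈ Matrix.unitaryGroup (Fin n) ℂ, ∀ X ∈ W, g * X * star g ∈ W)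
    (H : Matrix (Fin n) (Fin n) ℂ) (hH : H.IsHermitian) :
    (-Complex.I) • H ∈ W ↔
      (-Complex.I) • diagonal (fun i => (hH.eigenvalues i : ℂ)) ∈ W := by
  have hs := hH.spectral_theorem
  set V := (hH.eigenvectorUnitary : Matrix (Fin n) (Fin n) ℂ) with hVdef
  have hVm : V ∈ Matrix.unitaryGroup (Fin n) ℂ := hH.eigenvectorUnitary.2
  have hV := Unitary.mem_iff.1 hVm
  set D : Matrix (Fin n) (Fin n) ℂ := diagonal (fun i => (hH.eigenvalues i : ℂ)) with hD
  have h1 : H = V * D * star V := by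
    rw [hs, Unitary.conjStarAlgAut_apply]; rfl
  have h2 : D = star V * H * star (star V) := by
    rw [h1, star_star]
    calc D = (star V * V) * D * (star V * V) := by rw [hV.1]; simp
      _ = _ := by simp only [mul_assoc]
  constructor
  · intro h
    have := hW (star V) (Unitary.star_mem hVm) _ h
    rw [mul_smul_comm, smul_mul_assoc, ← h2] at this
    exact this
  · intro h
    have := hW V hVm _ h
    rw [mul_smul_comm, smul_mul_assoc, ← h1] at this
    exact this

theorem adspan_perm {n : ℕ} (W : Submodule ℝ (Matrix (Fin n) (Fin n) ℂ))
    (hW : ∀ g ∈ Matrix.unitaryGroup (Fin n) ℂ, ∀ X ∈ W, g * X * star g ∈ W)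
    (σ : Equiv.Perm (Fin n)) (d : Fin n → ℂ) (h : (-Complex.I) • diagonal d ∈ W) :
    (-Complex.I) • diagonal (fun i => d (σ i)) ∈ W := by
  set P : Matrix (Fin n) (Fin n) ℂ := σ.permMatrix ℂ with hP
  have hst : star P = (σ⁻¹).permMatrix ℂ := by
    rw [star_eq_conjTranspose, hP, Matrix.conjTranspose_permMatrix]
  have hPu : P ∈ Matrix.unitaryGroup (Fin n) ℂ := by
    rw [Matrix.mem_unitaryGroup_iff, hst, hP, ← Matrix.permMatrix_mul]
    simp
  have := hW P hPu _ h
  rw [mul_smul_comm, smul_mul_assoc] at this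
  convert this using 2
  rw [hst, hP]
  ext i j
  have hj : (Equiv.symm σ⁻¹) j = σ j := rfl
  simp [Equiv.Perm.permMatrix, PEquiv.toMatrix_toPEquiv_mul, PEquiv.mul_toMatrix_toPEquiv,
    diagonal_apply, hj]

theorem adspan_main {n : ℕ} (W : Submodule ℝ (Matrix (Fin n) (Fin n) ℂ))
    (hW : ∀ g ∈ Matrix.unitaryGroup (Fin n) ℂ, ∀ X ∈ W, g * X * star g ∈ W)
    (H₁ H₂ : Matrix (Fin n) (Fin n) ℂ) (hH₁ : H₁.IsHermitian) (hH₂ : H₂.IsHermitian)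
    (h₁ : (-Complex.I) • H₁ ∈ W) (h₂ : (-Complex.I) • H₂ ∈ W)
    (hns : ∀ c : ℝ, H₁ ≠ (c : ℂ) • (1 : Matrix (Fin n) (Fin n) ℂ)) (htr : H₂.trace ≠ 0) :
    ∀ Y, star Y = -Y → Y ∈ W := by
  -- work with real diagonals
  let L : (Fin n → ℝ) →ₗ[ℝ] Matrix (Fin n) (Fin n) ℂ :=
    { toFun := fun d => (-Complex.I) • diagonal (fun i => (d i : ℂ))
      map_add' := by
        intro d e; ext i j; by_cases h : i = j <;> simp [diagonal_apply, h, mul_add, add_comm]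
      map_smul' := by
        intro c d; ext i j; by_cases h : i = j <;> simp [diagonal_apply, h]; ring }
  have hL : ∀ d, L d = (-Complex.I) • diagonal (fun i => (d i : ℂ)) := fun d => rfl
  let D : Submodule ℝ (Fin n → ℝ) := W.comap L
  have hDp : ∀ (σ : Equiv.Perm (Fin n)) d, d ∈ D → (fun i => d (σ i)) ∈ D := by
    intro σ d hd
    exact adspan_perm W hW σ (fun i => (d i : ℂ)) hd
  have e₁ : hH₁.eigenvalues ∈ D := (adspan_diag W hW H₁ hH₁).1 h₁
  have e₂ : hH₂.eigenvalues ∈ D := (adspan_diag W hW H₂ hH₂).1 h₂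
  have hne : ∃ a b, hH₁.eigenvalues a ≠ hH₁.eigenvalues b := by
    by_contra hc
    push Not at hc
    have hs := hH₁.spectral_theorem
    obtain ⟨c, hcc⟩ : ∃ c : ℝ, ∀ i, hH₁.eigenvalues i = c := by
      rcases isEmpty_or_nonempty (Fin n) with h | ⟨⟨i⟩⟩
      · exact ⟨0, fun i => h.elim i⟩
      · exact ⟨_, fun j => hc j i⟩
    apply hns c
    rw [hs, Unitary.conjStarAlgAut_apply]
    have : diagonal (RCLike.ofReal ∘ hH₁.eigenvalues) = (c : ℂ) • (1 : Matrix (Fin n) (Fin n) ℂ) := by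
      ext i j; by_cases h : i = j <;> simp [diagonal_apply, h, hcc, one_apply]
    rw [this]
    simp
  obtain ⟨a, b, hab⟩ := hne
  have hab' : a ≠ b := fun h => hab (by rw [h])
  have hdiff : (Pi.single a (1:ℝ) - Pi.single b 1 : Fin n → ℝ) ∈ D := by
    have h := D.sub_mem e₁ (hDp (Equiv.swap a b) _ e₁)
    have h' := D.smul_mem (hH₁.eigenvalues a - hH₁.eigenvalues b)⁻¹ h
    convert h' using 1
    have hz := sub_ne_zero.2 hab
    ext i
    by_cases hia : i = a
    · subst hia; simp [hab', hz]
    · by_cases hib : i = b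
      · subst hib; simp [hia]; field_simp; ring
      · simp [hia, hib, Equiv.swap_apply_of_ne_of_ne]
  have hdiff' : ∀ c d, (Pi.single c (1:ℝ) - Pi.single d 1 : Fin n → ℝ) ∈ D := by
    intro c d
    by_cases hcd : c = d
    · subst hcd; simp
    obtain ⟨σ, hσ⟩ : ∃ σ : Equiv.Perm (Fin n), σ c = a ∧ σ d = b := by
      refine ⟨Equiv.swap (Equiv.swap c a d) b * Equiv.swap c a, ?_, ?_⟩
      · have h3 : a ≠ Equiv.swap c a d := by
          intro h
          apply hcd
          have := congrArg (Equiv.swap c a) h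
          simpa using this
        simp [Equiv.swap_apply_of_ne_of_ne h3 hab']
      · simp
    have h := hDp σ _ hdiff
    convert h using 1
    ext i
    have k1 : (i = c) ↔ (σ i = a) := by rw [← hσ.1]; simp
    have k2 : (i = d) ↔ (σ i = b) := by rw [← hσ.2]; simp
    simp [Pi.single_apply, k1, k2]
  have hsingle : ∀ c, (Pi.single c (1:ℝ) : Fin n → ℝ) ∈ D := by
    intro c
    set s : ℝ := ∑ i, hH₂.eigenvalues i with hs
    have hs0 : s ≠ 0 := by
      intro h
      apply htr
      rw [hH₂.trace_eq_sum_eigenvalues]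
      have : (∑ i, (hH₂.eigenvalues i : ℂ)) = (s : ℂ) := by rw [hs]; push_cast; rfl
      simpa [h] using this
    have h : ∑ i, hH₂.eigenvalues i • (Pi.single i (1:ℝ) - Pi.single c 1 : Fin n → ℝ) ∈ D :=
      D.sum_mem fun i _ => D.smul_mem _ (hdiff' i c)
    have h' := D.smul_mem s⁻¹ (D.sub_mem e₂ h)
    convert h' using 1
    have : ∑ i, hH₂.eigenvalues i • (Pi.single i (1:ℝ) - Pi.single c 1 : Fin n → ℝ)
        = hH₂.eigenvalues - s • Pi.single c 1 := by
      simp only [smul_sub, Finset.sum_sub_distrib, ← Finset.sum_smul, ← hs]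
      congr 1
      ext j
      simp [Finset.sum_apply, Pi.single_apply]
    rw [this, sub_sub_cancel, smul_smul, inv_mul_cancel₀ hs0, one_smul]
  have hall : ∀ d, d ∈ D := by
    intro d
    have : d = ∑ i, d i • (Pi.single i (1:ℝ) : Fin n → ℝ) := by
      ext j; simp [Finset.sum_apply, Pi.single_apply]
    rw [this]
    exact D.sum_mem fun i _ => D.smul_mem _ (hsingle i)
  intro Y hY
  have hHY : (Complex.I • Y).IsHermitian := by
    rw [Matrix.IsHermitian, ← star_eq_conjTranspose, star_smul, hY]
    simp
  have h := (adspan_diag W hW _ hHY).2 (hall hHY.eigenvalues)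
  simpa [smul_smul] using h
end AdSpan

section Conserve
open MeasureTheory Set Filter

theorem ac_of_dist_le {X : Type*} [PseudoMetricSpace X] {Y : Type*} [PseudoMetricSpace Y]
    {f : ℝ → X} {h : ℝ → Y} {a b : ℝ} (C : ℝ)
    (hh : AbsolutelyContinuousOnInterval h a b)
    (hle : ∀ x ∈ uIcc a b, ∀ y ∈ uIcc a b, dist (f x) (f y) ≤ C * dist (h x) (h y)) :
    AbsolutelyContinuousOnInterval f a b := by
  have h2 := Tendsto.const_mul C hh
  rw [mul_zero] at h2
  refine squeeze_zero' (Eventually.of_forall fun _ => Finset.sum_nonneg fun i hi => dist_nonneg)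
    ?_ h2
  rw [eventually_inf_principal]
  filter_upwards with E hE
  rw [Finset.mul_sum]
  refine Finset.sum_le_sum fun i hi => ?_
  have := hE.1 i hi
  exact hle _ this.1 _ this.2

theorem conserve_main {E : Type*} [NormedAddCommGroup E] [NormedSpace ℝ E]
    [FiniteDimensional ℝ E] {G : Type*} [NormedAddCommGroup G] [NormedSpace ℝ G]
    (F : E → G) (hF : ContDiff ℝ 1 F) (T : ℝ) (hT : 0 ≤ T) (γ f : ℝ → E)
    (hf : IntervalIntegrable f volume 0 T)
    (hγ : ∀ t ∈ Icc 0 T, γ t = γ 0 + ∫ s in (0:ℝ)..t, f s)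
    (hz : ∀ t ∈ Icc 0 T, fderiv ℝ F (γ t) (f t) = 0) : F (γ T) = F (γ 0) := by
  have : CompleteSpace E := FiniteDimensional.complete ℝ E
  have : ProperSpace E := FiniteDimensional.proper ℝ E
  set δ : ℝ → E := fun t => γ 0 + ∫ s in (0:ℝ)..t, f s with hδ
  have hI : uIcc 0 T = Icc 0 T := uIcc_of_le hT
  have hδac : AbsolutelyContinuousOnInterval δ 0 T := by
    refine ac_of_dist_le (h := fun t => ∫ s in (0:ℝ)..t, ‖f s‖) 1
      (hf.norm.absolutelyContinuousOnInterval_intervalIntegral (by simp)) ?_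
    intro x hx y hy
    have ix : IntervalIntegrable f volume 0 x := hf.mono_set (uIcc_subset_uIcc (by simp) hx)
    have iy : IntervalIntegrable f volume 0 y := hf.mono_set (uIcc_subset_uIcc (by simp) hy)
    rw [one_mul, hδ]
    simp only [dist_add_left]
    rw [dist_eq_norm, dist_eq_norm, intervalIntegral.integral_interval_sub_left ix iy,
      intervalIntegral.integral_interval_sub_left ix.norm iy.norm]
    exact intervalIntegral.norm_integral_le_abs_integral_norm
  obtain ⟨R, hR⟩ := hδac.exists_bound
  obtain ⟨K, hK⟩ := (hF.contDiffOn (s := Metric.closedBall 0 R)).exists_lipschitzOnWith (by decide)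
    (convex_closedBall _ _) (isCompact_closedBall _ _)
  have hac : AbsolutelyContinuousOnInterval (fun t => F (δ t)) 0 T := by
    refine ac_of_dist_le (h := δ) K hδac ?_
    intro x hx y hy
    exact hK.dist_le_mul _ (by simpa using hR x hx) _ (by simpa using hR y hy)
  obtain ⟨C, hC⟩ := hac.const_of_ae_hasDerivAt_zero (by
    filter_upwards [hf.ae_hasDerivAt_integral] with t ht htm
    have h1 : HasDerivAt δ (f t) t := (ht htm 0 (by simp)).const_add _
    have h2 : HasFDerivAt F (fderiv ℝ F (δ t)) (δ t) :=
      (hF.differentiable (by decide) _).hasFDerivAt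
    have h3 := h2.comp_hasDerivAt t h1
    have h4 : δ t = γ t := (hγ t (hI ▸ htm)).symm
    have h5 : fderiv ℝ F (δ t) (f t) = 0 := by rw [h4]; exact hz t (hI ▸ htm)
    rw [h5] at h3
    exact h3)
  have e0 : γ 0 = δ 0 := by simp [hδ]
  have eT : γ T = δ T := hγ T (by simp [hT])
  rw [e0, eT, hC 0 (by simp), hC T (by simp)]

end Conserve

section Concat
open MeasureTheory Set Filter

theorem integral_form_clm {E : Type*} [NormedAddCommGroup E] [NormedSpace ℝ E] [CompleteSpace E]
    (R : E →L[ℝ] E) (T : ℝ) (hT : 0 ≤ T) (γ f γ' f' : ℝ → E)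
    (hf : IntervalIntegrable f volume 0 T)
    (hγ : ∀ t ∈ Icc 0 T, γ t = γ 0 + ∫ s in (0:ℝ)..t, f s)
    (h1 : ∀ t, γ' t = R (γ t)) (h2 : ∀ t, f' t = R (f t)) :
    IntervalIntegrable f' volume 0 T ∧ ∀ t ∈ Icc 0 T, γ' t = γ' 0 + ∫ s in (0:ℝ)..t, f' s := by
  have hfun : f' = fun t => R (f t) := funext h2
  subst hfun
  refine ⟨⟨R.integrable_comp hf.1, R.integrable_comp hf.2⟩, ?_⟩
  intro t ht
  rw [R.intervalIntegral_comp_comm (hf.mono_set (by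
      rw [uIcc_of_le ht.1, uIcc_of_le hT]; exact Icc_subset_Icc_right ht.2)), h1, h1, ← map_add,
      ← hγ t ht]

theorem integral_form_concat {E : Type*} [NormedAddCommGroup E] [NormedSpace ℝ E]
    [CompleteSpace E] (T S : ℝ) (hT : 0 ≤ T) (hS : 0 ≤ S) (g k l f₁ f₂ f : ℝ → E)
    (hg2 : IntervalIntegrable f₁ volume 0 T)
    (hg3 : ∀ t ∈ Icc 0 T, g t = g 0 + ∫ s in (0:ℝ)..t, f₁ s)
    (hk2 : IntervalIntegrable f₂ volume 0 S)
    (hk3 : ∀ t ∈ Icc 0 S, k t = k 0 + ∫ s in (0:ℝ)..t, f₂ s)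
    (hk0 : k 0 = g T)
    (hl1 : ∀ t ≤ T, l t = g t) (hl2 : ∀ t, T ≤ t → l t = k (t - T))
    (hf1 : ∀ t ≤ T, f t = f₁ t) (hf2 : ∀ t, T < t → f t = f₂ (t - T)) :
    IntervalIntegrable f volume 0 (T + S) ∧
      ∀ t ∈ Icc 0 (T + S), l t = l 0 + ∫ s in (0:ℝ)..t, f s := by
  have hI1 : IntervalIntegrable f volume 0 T := by
    refine (intervalIntegrable_congr ?_).2 hg2
    intro s hs
    rw [uIoc_of_le hT] at hs
    exact hf1 s hs.2
  have hI2' : IntervalIntegrable (fun s => f₂ (s - T)) volume T (T + S) := by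
    have := hk2.comp_sub_right T
    simpa [add_comm] using this
  have hcong2 : ∀ t ∈ Icc T (T + S), EqOn f (fun s => f₂ (s - T)) (uIoc T t) := by
    intro t ht s hs
    rw [uIoc_of_le ht.1] at hs
    exact hf2 s hs.1
  have hI2 : IntervalIntegrable f volume T (T + S) :=
    (intervalIntegrable_congr (hcong2 (T + S) (by simp [hS]))).2 hI2'
  refine ⟨hI1.trans hI2, ?_⟩
  have hfirst : ∀ t ∈ Icc 0 T, l t = l 0 + ∫ s in (0:ℝ)..t, f s := by
    intro t ht
    rw [hl1 t ht.2, hl1 0 hT, hg3 t ht]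
    congr 1
    refine intervalIntegral.integral_congr_ae (Eventually.of_forall fun s hs => ?_)
    rw [uIoc_of_le ht.1] at hs
    exact (hf1 s (hs.2.trans ht.2)).symm
  intro t ht
  rcases le_or_gt t T with h | h
  · exact hfirst t ⟨ht.1, h⟩
  · have hi : IntervalIntegrable f volume T t :=
      hI2.mono_set (by
        rw [uIcc_of_le h.le, uIcc_of_le (by linarith)]; exact Icc_subset_Icc_right ht.2)
    rw [← intervalIntegral.integral_add_adjacent_intervals hI1 hi, ← add_assoc,
      ← hfirst T (by simp [hT]), hl2 t h.le, hl1 T le_rfl,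
      hk3 (t - T) ⟨by linarith, by linarith [ht.2]⟩, hk0]
    congr 1
    rw [intervalIntegral.integral_congr_ae (Eventually.of_forall (hcong2 t ⟨h.le, ht.2⟩)),
      intervalIntegral.integral_comp_sub_right f₂ T, sub_self]

end Concat


section Dynamics
open MeasureTheory Set Filter

theorem lineDeriv_zero_of_hasDerivAt {n : ℕ} {G : Type*} [NormedAddCommGroup G] [NormedSpace ℝ G]
    (F : Matrix (Fin n) (Fin n) ℂ → G) (hF : ContDiff ℝ 1 F) (x v : Matrix (Fin n) (Fin n) ℂ)
    (h : HasDerivAt (fun τ : ℝ => F (x + τ • v)) 0 0) : fderiv ℝ F x v = 0 :=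
  ((hF.differentiable (by decide) x).hasFDerivAt.hasLineDerivAt v).unique h

theorem reach_det {n m : ℕ} (U : Set (EuclideanSpace ℝ (Fin m)))
    (Hmat : EuclideanSpace ℝ (Fin m) → Matrix (Fin n) (Fin n) ℂ)
    (htr : ∀ u ∈ U, (Hmat u).trace = 0) (g0 g1 : Matrix (Fin n) (Fin n) ℂ)
    (h : g1 ∈ liftedReachable U Hmat g0) : g1.det = g0.det := by
  obtain ⟨T, hT, u, g, hu, hg, rfl, rfl⟩ := h
  have hentry : ∀ i j, ContDiff ℝ 1 (fun M : Matrix (Fin n) (Fin n) ℂ => M i j) := fun i j =>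
    ((Matrix.entryLinearMap ℝ ℂ i j).toContinuousLinearMap).contDiff
  have hdet : ContDiff ℝ 1 (fun M : Matrix (Fin n) (Fin n) ℂ => M.det) := by
    simp only [Matrix.det_apply']
    exact ContDiff.sum fun σ _ => contDiff_const.mul (contDiff_prod fun i _ => hentry _ _)
  refine conserve_main (fun M : Matrix (Fin n) (Fin n) ℂ => M.det) hdet T hT g _ hg.2.1 hg.2.2 ?_
  intro t ht
  refine lineDeriv_zero_of_hasDerivAt _ hdet _ _ ?_
  have hA : ∀ τ : ℝ, (g t + τ • ((-Complex.I) • (Hmat (u t) * g t))).det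
      = (1 + (τ : ℂ) • ((-Complex.I) • Hmat (u t))).det * (g t).det := by
    intro τ
    rw [← Matrix.det_mul, add_mul, one_mul, smul_mul_assoc, smul_mul_assoc]
    rfl
  simp only [hA]
  simp_rw [fun τ : ℝ => Matrix.det_one_add_smul (τ : ℂ) ((-Complex.I) • Hmat (u t))]
  rw [Matrix.trace_smul, htr _ (hu.2.1 t ht)]
  set p := Polynomial.divX (Polynomial.divX
    (1 + (Polynomial.X : Polynomial ℂ) • ((-Complex.I) • Hmat (u t)).map Polynomial.C).det) with hp
  have hd : HasDerivAt (fun z : ℂ => (1 + (-Complex.I) • (0:ℂ) * z + p.eval z * z ^ 2) * (g t).det) 0 ((0:ℝ):ℂ) := by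
    have h1 := (((p.hasDerivAt ((0:ℝ):ℂ)).mul ((hasDerivAt_id ((0:ℝ):ℂ)).pow 2)).const_add 1).mul_const (g t).det
    simpa using h1
  exact hd.comp_ofReal

theorem reach_scalar {n m : ℕ} (U : Set (EuclideanSpace ℝ (Fin m)))
    (Hmat : EuclideanSpace ℝ (Fin m) → Matrix (Fin n) (Fin n) ℂ)
    (hsc : ∀ u ∈ U, ∃ c : ℝ, Hmat u = (c : ℂ) • 1) (g0 g1 : Matrix (Fin n) (Fin n) ℂ)
    (h : g1 ∈ liftedReachable U Hmat g0) (i j : Fin n) : ‖g1 i j‖ ^ 2 = ‖g0 i j‖ ^ 2 := by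
  obtain ⟨T, hT, u, g, hu, hg, rfl, rfl⟩ := h
  have hentry : ContDiff ℝ 1 (fun M : Matrix (Fin n) (Fin n) ℂ => M i j) :=
    ((Matrix.entryLinearMap ℝ ℂ i j).toContinuousLinearMap).contDiff
  have hF : ContDiff ℝ 1 (fun M : Matrix (Fin n) (Fin n) ℂ => ‖M i j‖ ^ 2) := hentry.norm_sq ℝ
  refine conserve_main (fun M : Matrix (Fin n) (Fin n) ℂ => ‖M i j‖ ^ 2) hF T hT g _
    hg.2.1 hg.2.2 ?_
  intro t ht
  refine lineDeriv_zero_of_hasDerivAt _ hF _ _ ?_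
  obtain ⟨c, hc⟩ := hsc _ (hu.2.1 t ht)
  have hA : ∀ τ : ℝ, ‖(g t + τ • ((-Complex.I) • (Hmat (u t) * g t))) i j‖ ^ 2
      = (1 + c ^ 2 * τ ^ 2) * ‖g t i j‖ ^ 2 := by
    intro τ
    rw [hc, smul_mul_assoc, one_mul]
    have : (g t + τ • ((-Complex.I) • ((c : ℂ) • g t))) i j
        = (1 - (c * τ : ℝ) * Complex.I) * g t i j := by
      simp [Matrix.add_apply, Matrix.smul_apply]; ring
    rw [this, norm_mul, mul_pow, ← Complex.normSq_eq_norm_sq]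
    congr 1
    simp [Complex.normSq_apply]; ring
  simp only [hA]
  have h1 := (((((hasDerivAt_id (0:ℝ)).pow 2).const_mul (c^2)).const_add 1).mul_const
    (‖g t i j‖ ^ 2))
  simpa using h1

theorem reach_subset {n m : ℕ} (U : Set (EuclideanSpace ℝ (Fin m)))
    (Hmat : EuclideanSpace ℝ (Fin m) → Matrix (Fin n) (Fin n) ℂ)
    (g0 g1 : Matrix (Fin n) (Fin n) ℂ)
    (h : g1 ∈ liftedReachable U Hmat g0) : g1 ∈ Matrix.unitaryGroup (Fin n) ℂ := by
  obtain ⟨T, hT, u, g, hu, hg, rfl, rfl⟩ := h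
  exact hg.1 T (by simp [hT])

theorem reach_right {n m : ℕ} (U : Set (EuclideanSpace ℝ (Fin m)))
    (Hmat : EuclideanSpace ℝ (Fin m) → Matrix (Fin n) (Fin n) ℂ)
    (g0 g1 k : Matrix (Fin n) (Fin n) ℂ) (hk : k ∈ Matrix.unitaryGroup (Fin n) ℂ)
    (h : g1 ∈ liftedReachable U Hmat g0) : g1 * k ∈ liftedReachable U Hmat (g0 * k) := by
  obtain ⟨T, hT, u, g, hu, ⟨hg1, hg2, hg3⟩, rfl, rfl⟩ := h
  refine ⟨T, hT, u, fun t => g t * k, hu, ⟨?_, ?_, ?_⟩, rfl, rfl⟩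
  · intro t ht
    exact mul_mem (hg1 t ht) hk
  all_goals
    have hmain := integral_form_clm (LinearMap.mulRight ℝ k).toContinuousLinearMap T hT g
      (fun s => (-Complex.I) • (Hmat (u s) * g s)) (fun t => g t * k)
      (fun s => (-Complex.I) • (Hmat (u s) * (g s * k))) hg2 hg3 (fun t => rfl)
      (fun t => by
        change _ = ((-Complex.I) • (Hmat (u t) * g t)) * k
        rw [smul_mul_assoc, mul_assoc])
  · exact hmain.1
  · exact hmain.2

theorem reach_trans {n m : ℕ} (U : Set (EuclideanSpace ℝ (Fin m)))
    (Hmat : EuclideanSpace ℝ (Fin m) → Matrix (Fin n) (Fin n) ℂ)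
    (g0 g1 g2 : Matrix (Fin n) (Fin n) ℂ)
    (h1 : g1 ∈ liftedReachable U Hmat g0) (h2 : g2 ∈ liftedReachable U Hmat g1) :
    g2 ∈ liftedReachable U Hmat g0 := by
  obtain ⟨T, hT, u, g, ⟨hu1, hu2, C, hu3⟩, ⟨hg1, hg2, hg3⟩, rfl, rfl⟩ := h1
  obtain ⟨S, hS, v, k, ⟨hv1, hv2, D, hv3⟩, ⟨hk1, hk2, hk3⟩, hk0, rfl⟩ := h2
  set w : ℝ → EuclideanSpace ℝ (Fin m) := fun t => if t ≤ T then u t else v (t - T) with hw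
  set l : ℝ → Matrix (Fin n) (Fin n) ℂ := fun t => if t ≤ T then g t else k (t - T) with hl
  have hw1 : ∀ t ≤ T, w t = u t := fun t ht => if_pos ht
  have hw2 : ∀ t, T < t → w t = v (t - T) := fun t ht => if_neg (not_le.2 ht)
  have hl1 : ∀ t ≤ T, l t = g t := fun t ht => if_pos ht
  have hl2 : ∀ t, T ≤ t → l t = k (t - T) := by
    intro t ht
    rcases ht.eq_or_lt with rfl | ht
    · rw [hl1 _ le_rfl, sub_self, hk0]
    · exact if_neg (not_le.2 ht)
  have hmain := integral_form_concat T S hT hS g k l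
    (fun s => (-Complex.I) • (Hmat (u s) * g s)) (fun s => (-Complex.I) • (Hmat (v s) * k s))
    (fun s => (-Complex.I) • (Hmat (w s) * l s)) hg2 hg3 hk2 hk3 hk0 hl1 hl2
    (fun t ht => by simp only [hw1 t ht, hl1 t ht])
    (fun t ht => by simp only [hw2 t ht, hl2 t ht.le])
  refine ⟨T + S, by positivity, w, l, ⟨?_, ?_, ?_⟩, ⟨?_, hmain.1, hmain.2⟩, hl1 0 hT, ?_⟩
  · rw [← Icc_union_Ioc_eq_Icc hT (le_add_of_nonneg_right hS), aestronglyMeasurable_union_iff]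
    constructor
    · refine hu1.congr ?_
      filter_upwards [ae_restrict_mem measurableSet_Icc] with t ht
      exact (hw1 t ht.2).symm
    · have hmp : MeasurePreserving (fun t : ℝ => t - T)
          (volume.restrict ((fun t : ℝ => t - T) ⁻¹' (Icc 0 S))) (volume.restrict (Icc 0 S)) :=
        (measurePreserving_sub_right volume T).restrict_preimage measurableSet_Icc
      have h3 := hv1.comp_measurePreserving hmp
      have h4 : Ioc T (T + S) ⊆ (fun t : ℝ => t - T) ⁻¹' (Icc 0 S) := by
        intro t ht
        simp only [mem_preimage, mem_Icc]
        constructor <;> linarith [ht.1, ht.2]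
      refine (h3.mono_set h4).congr ?_
      filter_upwards [ae_restrict_mem measurableSet_Ioc] with t ht
      exact (hw2 t ht.1).symm
  · intro t ht
    rcases le_or_gt t T with h | h
    · rw [hw1 t h]; exact hu2 t ⟨ht.1, h⟩
    · rw [hw2 t h]; exact hv2 _ ⟨by linarith, by linarith [ht.2]⟩
  · refine ⟨max C D, ?_⟩
    intro t ht
    rcases le_or_gt t T with h | h
    · rw [hw1 t h]; exact (hu3 t ⟨ht.1, h⟩).trans (le_max_left _ _)
    · rw [hw2 t h]; exact (hv3 _ ⟨by linarith, by linarith [ht.2]⟩).trans (le_max_right _ _)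
  · intro t ht
    rcases le_or_gt t T with h | h
    · rw [hl1 t h]; exact hg1 t ⟨ht.1, h⟩
    · rw [hl2 t h.le]; exact hk1 _ ⟨by linarith, by linarith [ht.2]⟩
  · rw [hl2 _ (by linarith), add_sub_cancel_left]

theorem exp_hasDerivAt_matrix {n : ℕ} (A : Matrix (Fin n) (Fin n) ℂ) (t : ℝ) :
    HasDerivAt (fun τ : ℝ => NormedSpace.exp (τ • A)) (A * NormedSpace.exp (t • A)) t :=
  @hasDerivAt_exp_smul_const' ℝ (Matrix (Fin n) (Fin n) ℂ) _ Matrix.linftyOpNormedRing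
    Matrix.linftyOpNormedAlgebra (FiniteDimensional.complete ℝ _) A t

theorem reach_exp {n m : ℕ} (U : Set (EuclideanSpace ℝ (Fin m)))
    (Hmat : EuclideanSpace ℝ (Fin m) → Matrix (Fin n) (Fin n) ℂ)
    (hherm : ∀ u ∈ U, (Hmat u).IsHermitian) (u : EuclideanSpace ℝ (Fin m)) (hu : u ∈ U)
    (t : ℝ) (ht : 0 ≤ t) :
    NormedSpace.exp (t • ((-Complex.I) • Hmat u)) ∈ liftedReachable U Hmat 1 := by
  set A := (-Complex.I) • Hmat u with hA
  have hcont : Continuous fun s : ℝ => A * NormedSpace.exp (s • A) := by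
    have h1 : Continuous fun s : ℝ => NormedSpace.exp (s • A) :=
      continuous_iff_continuousAt.2 fun s => (exp_hasDerivAt_matrix A s).continuousAt
    exact continuous_const.mul h1
  have hsk : ∀ s : ℝ, star (s • A) = -(s • A) := by
    intro s
    have : star (Hmat u) = Hmat u := hherm u hu
    simp [hA, star_smul, this]
  refine ⟨t, ht, fun _ => u, fun s => NormedSpace.exp (s • A), ⟨aestronglyMeasurable_const,
    fun _ _ => hu, ‖u‖, fun _ _ => le_rfl⟩, ⟨?_, ?_, ?_⟩, by simp, rfl⟩
  · intro s _
    have h0 : star (NormedSpace.exp (s • A)) = NormedSpace.exp (-(s • A)) := by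
      rw [← hsk, Matrix.star_eq_conjTranspose, Matrix.star_eq_conjTranspose,
        Matrix.exp_conjTranspose]
    rw [Matrix.mem_unitaryGroup_iff, h0, ← Matrix.exp_add_of_commute _ _ ((Commute.refl (s • A)).neg_right)]
    simp
  all_goals
    have hfun : (fun s : ℝ => (-Complex.I) • (Hmat u * NormedSpace.exp (s • A)))
        = fun s => A * NormedSpace.exp (s • A) := by
      funext s
      rw [hA, smul_mul_assoc]
    simp only [hfun]
  · exact hcont.intervalIntegrable _ _
  · intro s _
    rw [intervalIntegral.integral_eq_sub_of_hasDerivAt (fun x _ => exp_hasDerivAt_matrix A x)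
      (hcont.intervalIntegrable _ _)]
    abel

end Dynamics

section Assemble
open Filter Topology

theorem swap_matrix_unitary {n : ℕ} (σ : Equiv.Perm (Fin n)) :
    (σ.permMatrix ℂ : Matrix (Fin n) (Fin n) ℂ) ∈ Matrix.unitaryGroup (Fin n) ℂ := by
  rw [Matrix.mem_unitaryGroup_iff, Matrix.star_eq_conjTranspose, Matrix.conjTranspose_permMatrix,
    ← Matrix.permMatrix_mul]
  simp

theorem krener_matrix {n : ℕ} (S : Set (Matrix (Fin n) (Fin n) ℂ))
    (hSu : S ⊆ unitary (Matrix (Fin n) (Fin n) ℂ)) (hne : S.Nonempty)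
    (hmul : ∀ x ∈ S, ∀ y ∈ S, x * y ∈ S) (𝒜 : Set (Matrix (Fin n) (Fin n) ℂ))
    (hexp : ∀ A ∈ 𝒜, ∀ t : ℝ, 0 ≤ t → NormedSpace.exp (t • A) ∈ S)
    (hspan : ∀ h ∈ S, ∀ V : Submodule ℝ (Matrix (Fin n) (Fin n) ℂ),
      (∀ s ∈ S, ∀ A ∈ 𝒜, (h * s) * A * star (h * s) ∈ V) → ∀ Y, star Y = -Y → Y ∈ V) :
    ∃ x ∈ S, ∀ᶠ g in 𝓝 x, g ∈ unitary (Matrix (Fin n) (Fin n) ℂ) → g ∈ S :=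
  @krener_abstract (Matrix (Fin n) (Fin n) ℂ) Matrix.linftyOpNormedRing
    Matrix.linftyOpNormedAlgebra (inferInstanceAs (FiniteDimensional ℝ (Matrix (Fin n) (Fin n) ℂ)))
    _ (inferInstanceAs (ContinuousStar (Matrix (Fin n) (Fin n) ℂ)))
    (inferInstanceAs (StarModule ℝ (Matrix (Fin n) (Fin n) ℂ))) S hSu hne hmul 𝒜 hexp hspan

theorem exact_of_approx {n m : ℕ} (hn : 2 ≤ n)
    (U : Set (EuclideanSpace ℝ (Fin m)))
    (Hmat : EuclideanSpace ℝ (Fin m) → Matrix (Fin n) (Fin n) ℂ)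
    (hherm : ∀ u ∈ U, (Hmat u).IsHermitian)
    (hdense : (Matrix.unitaryGroup (Fin n) ℂ : Set (Matrix (Fin n) (Fin n) ℂ)) ⊆
        closure (liftedReachable U Hmat 1)) (g : Matrix (Fin n) (Fin n) ℂ)
    (hg : g ∈ Matrix.unitaryGroup (Fin n) ℂ) : g ∈ liftedReachable U Hmat 1 := by
  set S := liftedReachable U Hmat 1 with hS
  have hSu : ∀ x ∈ S, x ∈ Matrix.unitaryGroup (Fin n) ℂ := fun x hx => reach_subset _ _ _ _ hx
  have hmul : ∀ x ∈ S, ∀ y ∈ S, x * y ∈ S := by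
    intro x hx y hy
    have h := reach_right U Hmat 1 x y (hSu y hy) hx
    rw [one_mul] at h
    exact reach_trans U Hmat 1 y _ hy h
  let i0 : Fin n := ⟨0, by omega⟩
  let i1 : Fin n := ⟨1, by omega⟩
  have h01 : i0 ≠ i1 := by simp [i0, i1]
  set σ : Equiv.Perm (Fin n) := Equiv.swap i0 i1 with hσ
  have hσu := hdense (swap_matrix_unitary σ)
  have hsc : ∃ u ∈ U, ∀ c : ℝ, Hmat u ≠ (c : ℂ) • 1 := by
    by_contra hc
    push Not at hc
    have hcl : IsClosed {M : Matrix (Fin n) (Fin n) ℂ | ‖M i0 i1‖ ^ 2 = 0} := by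
      refine isClosed_eq ?_ continuous_const
      exact ((continuous_id.matrix_elem i0 i1).norm).pow 2
    have hsub : S ⊆ {M : Matrix (Fin n) (Fin n) ℂ | ‖M i0 i1‖ ^ 2 = 0} := by
      intro M hM
      have := reach_scalar U Hmat hc 1 M hM i0 i1
      simpa [h01] using this
    have := closure_minimal hsub hcl hσu
    simp [Equiv.Perm.permMatrix, PEquiv.toMatrix_apply, hσ] at this
  have htr : ∃ u ∈ U, (Hmat u).trace ≠ 0 := by
    by_contra hc
    push Not at hc
    have hcl : IsClosed {M : Matrix (Fin n) (Fin n) ℂ | M.det = 1} :=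
      isClosed_eq (continuous_id.matrix_det) continuous_const
    have hsub : S ⊆ {M : Matrix (Fin n) (Fin n) ℂ | M.det = 1} := by
      intro M hM
      have := reach_det U Hmat hc 1 M hM
      simpa using this
    have := closure_minimal hsub hcl hσu
    simp only [Set.mem_setOf_eq, Matrix.det_permutation, hσ, Equiv.Perm.sign_swap h01] at this
    norm_num at this
  obtain ⟨u₁, hu₁, hns⟩ := hsc
  obtain ⟨u₂, hu₂, htr⟩ := htr
  have hne : S.Nonempty := closure_nonempty_iff.1 ⟨_, hσu⟩
  obtain ⟨x, hx, hev⟩ := krener_matrix S hSu hne hmul ((fun u => (-Complex.I) • Hmat u) '' U)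
    (by
      rintro _ ⟨u, hu, rfl⟩ t ht
      exact reach_exp U Hmat hherm u hu t ht)
    (by
      intro h hh V hV
      have hhu := Unitary.mem_iff.1 (hSu h hh)
      set W : Submodule ℝ (Matrix (Fin n) (Fin n) ℂ) := Submodule.span ℝ
        {Y | ∃ g ∈ Matrix.unitaryGroup (Fin n) ℂ, ∃ u ∈ U,
          Y = g * ((-Complex.I) • Hmat u) * star g} with hW
      have hWV : W ≤ V := by
        rw [hW, Submodule.span_le]
        rintro _ ⟨k, hk, u, hu, rfl⟩
        have hVc : IsClosed (V : Set (Matrix (Fin n) (Fin n) ℂ)) := V.closed_of_finiteDimensional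
        have hcont : Continuous fun s : Matrix (Fin n) (Fin n) ℂ =>
            (h * s) * ((-Complex.I) • Hmat u) * star (h * s) := by fun_prop
        have hcl := closure_minimal (s := S) (t := (fun s : Matrix (Fin n) (Fin n) ℂ =>
            (h * s) * ((-Complex.I) • Hmat u) * star (h * s)) ⁻¹' V)
          (fun s hs => hV s hs _ ⟨u, hu, rfl⟩) (hVc.preimage hcont)
        have := hcl (hdense (mul_mem (Unitary.star_mem (hSu h hh)) hk : star h * k ∈ _))
        simpa only [Set.mem_preimage, ← mul_assoc h, hhu.2, one_mul] using this
      have hWinv : ∀ g ∈ Matrix.unitaryGroup (Fin n) ℂ, ∀ X ∈ W, g * X * star g ∈ W := by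
        intro k hk X hX
        have hle : W ≤ W.comap ((LinearMap.mulRight ℝ (star k)).comp (LinearMap.mulLeft ℝ k)) := by
          rw [hW, Submodule.span_le]
          rintro _ ⟨k', hk', u, hu, rfl⟩
          refine Submodule.subset_span ⟨k * k', mul_mem hk hk', u, hu, ?_⟩
          change k * (k' * ((-Complex.I) • Hmat u) * star k') * star k = _
          rw [star_mul]
          simp only [mul_assoc]
        exact hle hX
      have hmem : ∀ u ∈ U, (-Complex.I) • Hmat u ∈ W := fun u hu =>
        Submodule.subset_span ⟨1, one_mem _, u, hu, by simp⟩
      intro Y hY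
      exact hWV (adspan_main W hWinv _ _ (hherm u₁ hu₁) (hherm u₂ hu₂) (hmem u₁ hu₁)
        (hmem u₂ hu₂) hns htr Y hY))
  have hxu := Unitary.mem_iff.1 (hSu x hx)
  have hgu := Unitary.mem_iff.1 hg
  have hcont : Continuous fun s : Matrix (Fin n) (Fin n) ℂ => g * star s := by fun_prop
  have hlim : g * star (star x * g) = x := by
    rw [star_mul, star_star, ← mul_assoc, hgu.2, one_mul]
  have hev' : ∀ᶠ s in 𝓝 (star x * g), g * star s ∈ unitary (Matrix (Fin n) (Fin n) ℂ) →
      g * star s ∈ S := by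
    have ht := hcont.tendsto (star x * g)
    simp only [hlim] at ht
    exact Filter.Tendsto.eventually
      (p := fun y => y ∈ unitary (Matrix (Fin n) (Fin n) ℂ) → y ∈ S) ht hev
  have hfr := mem_closure_iff_frequently.1
    (hdense (mul_mem (Unitary.star_mem (hSu x hx)) hg : star x * g ∈ _))
  obtain ⟨s, hs, hs'⟩ := (hfr.and_eventually hev').exists
  have h1 := hs' (mul_mem hg (Unitary.star_mem (hSu s hs)))
  have h2 := hmul _ h1 _ hs
  rwa [mul_assoc, (Unitary.mem_iff.1 (hSu s hs)).1, mul_one] at h2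

end Assemble

/-- Theorem 4.1 of the paper, lifted version. For the lifted quantum
control system `i·ġ = H(u)·g` on the unitary group `U(n)` (with `u ↦ H(u)` a smooth
family of Hermitian matrices), approximate controllability is equivalent to exact
controllability. -/
theorem approx_iff_exact_controllability_unitary {n m : ℕ} (hn : 2 ≤ n)
    (U : Set (EuclideanSpace ℝ (Fin m)))
    (Hmat : EuclideanSpace ℝ (Fin m) → Matrix (Fin n) (Fin n) ℂ)
    (hherm : ∀ u ∈ U, (Hmat u).IsHermitian)
    (hsmooth : ContDiffOn ℝ (⊤ : ℕ∞) Hmat U) :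
    (∀ g0 ∈ Matrix.unitaryGroup (Fin n) ℂ,
      (Matrix.unitaryGroup (Fin n) ℂ : Set (Matrix (Fin n) (Fin n) ℂ)) ⊆
        closure (liftedReachable U Hmat g0)) ↔
    (∀ g0 ∈ Matrix.unitaryGroup (Fin n) ℂ,
      liftedReachable U Hmat g0 =
        (Matrix.unitaryGroup (Fin n) ℂ : Set (Matrix (Fin n) (Fin n) ℂ))) := by
  constructor
  · intro h g0 hg0
    ext g1
    refine ⟨fun h1 => reach_subset _ _ _ _ h1, fun h1 => ?_⟩
    have h1' : g1 ∈ Matrix.unitaryGroup (Fin n) ℂ := h1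
    have h2 := exact_of_approx hn U Hmat hherm (h 1 (one_mem _)) (g1 * star g0)
      (mul_mem h1' (Unitary.star_mem hg0))
    have h3 := reach_right U Hmat 1 _ g0 hg0 h2
    rwa [mul_assoc, (Unitary.mem_iff.1 hg0).1, mul_one, one_mul] at h3
  · intro h g0 hg0
    rw [h g0 hg0]
    exact subset_closure
end

section
/- Let n ≥ 2, U ⊆ ℝ^m, and let u ↦ H(u) assign to each u ∈ U an n×n complex Hermitian matrix, depending smoothly on u. Let 𝒢 be a subgroup of U(n) that acts transitively on the unit sphere S^{2n−1} ⊂ ℂ^n. If the reachable set from the identity of the lifted control system i·ġ(t) = H(u(t))·g(t) is dense in 𝒢, then the control system i·ψ̇(t) = H(u(t))·ψ(t) on S^{2n−1} is exactly controllable: the reachable set from every ψ0 ∈ S^{2n−1} is all of S^{2n−1}. -/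
attribute [local instance] Matrix.normedAddCommGroup Matrix.normedSpace

section PartA

set_option linter.unusedSectionVars false

open ComplexConjugate

variable {E : Type*} [NormedAddCommGroup E] [InnerProductSpace ℂ E] [FiniteDimensional ℂ E]

/-- A positive semidefinite symmetric operator whose form vanishes at `z` kills `z`. -/
lemma aux_psd_ker (S : E →L[ℂ] E) (hS : ∀ x y, inner ℂ (S x) y = inner ℂ x (S y))
    (hpos : ∀ w, 0 ≤ (inner ℂ w (S w)).re) (z : E) (hz : (inner ℂ z (S z)).re = 0) : S z = 0 := by
  by_contra hne
  have hn : 0 < ‖S z‖ ^ 2 := by positivity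
  set b := (inner ℂ (S z) (S (S z))).re with hb
  have key : ∀ t : ℝ, 0 ≤ 2 * t * ‖S z‖ ^ 2 + t ^ 2 * b := by
    intro t
    have h := hpos (z + (t : ℂ) • S z)
    have h1 : inner ℂ (S z) (S z) = ((‖S z‖ ^ 2 : ℝ) : ℂ) := by
      rw [inner_self_eq_norm_sq_to_K]; simp
    have h2 : inner ℂ z (S (S z)) = ((‖S z‖ ^ 2 : ℝ) : ℂ) := by
      rw [← hS, h1]
    simp only [map_add, map_smul, inner_add_left, inner_add_right, inner_smul_left,
      inner_smul_right, h1, h2, Complex.add_re, hz, Complex.conj_ofReal, Complex.re_ofReal_mul,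
      Complex.ofReal_re] at h
    rw [← hb] at h
    nlinarith
  have hb0 : 0 ≤ b := hpos (S z)
  have h := key (-(‖S z‖ ^ 2) / (b + 1))
  have h1 : 2 * (-(‖S z‖ ^ 2) / (b + 1)) * ‖S z‖ ^ 2 + (-(‖S z‖ ^ 2) / (b + 1)) ^ 2 * b
      = - (‖S z‖ ^ 2 / (b + 1)) ^ 2 * (b + 2) := by
    field_simp
    ring
  rw [h1] at h
  have : 0 < (‖S z‖ ^ 2 / (b + 1)) ^ 2 * (b + 2) := by positivity
  linarith

/-- The (negative) trace form. -/
noncomputable def auxB (X Y : E →L[ℂ] E) : ℝ :=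
  -(LinearMap.trace ℂ E ((X : E →ₗ[ℂ] E) * (Y : E →ₗ[ℂ] E))).re

lemma auxB_symm (X Y : E →L[ℂ] E) : auxB X Y = auxB Y X := by
  simp only [auxB, LinearMap.trace_mul_comm ℂ (X : E →ₗ[ℂ] E)]

lemma auxB_add_left (X Y Z : E →L[ℂ] E) : auxB (X + Y) Z = auxB X Z + auxB Y Z := by
  simp only [auxB, ContinuousLinearMap.toLinearMap_add, add_mul, map_add, Complex.add_re]; ring

lemma auxB_smul_left (c : ℝ) (X Z : E →L[ℂ] E) : auxB (c • X) Z = c * auxB X Z := by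
  have : ((c • X : E →L[ℂ] E) : E →ₗ[ℂ] E) = (c : ℂ) • (X : E →ₗ[ℂ] E) := by
    ext x; simp
  simp only [auxB, this, smul_mul_assoc, map_smul, smul_eq_mul, Complex.re_ofReal_mul]; ring

lemma auxB_add_right (X Y Z : E →L[ℂ] E) : auxB Z (X + Y) = auxB Z X + auxB Z Y := by
  rw [auxB_symm, auxB_add_left, auxB_symm X, auxB_symm Y]

lemma auxB_smul_right (c : ℝ) (X Z : E →L[ℂ] E) : auxB Z (c • X) = c * auxB Z X := by
  rw [auxB_symm, auxB_smul_left, auxB_symm X]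

lemma auxB_self (X : E →L[ℂ] E) (hX : ∀ x y, inner ℂ (X x) y = -inner ℂ x (X y)) :
    auxB X X = ∑ i, ‖X (stdOrthonormalBasis ℂ E i)‖ ^ 2 := by
  rw [auxB, LinearMap.trace_eq_sum_inner _ (stdOrthonormalBasis ℂ E), Complex.re_sum,
    ← Finset.sum_neg_distrib]
  refine Finset.sum_congr rfl fun i _ => ?_
  have := hX (stdOrthonormalBasis ℂ E i) (X (stdOrthonormalBasis ℂ E i))
  rw [inner_self_eq_norm_sq_to_K] at this
  have h2 := congrArg Complex.re this
  simp only [Complex.neg_re] at h2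
  simp only [Module.End.mul_apply, ContinuousLinearMap.coe_coe]
  rw [← h2]
  norm_cast

lemma auxB_self_nonneg (X : E →L[ℂ] E) (hX : ∀ x y, inner ℂ (X x) y = -inner ℂ x (X y)) :
    0 ≤ auxB X X := by
  rw [auxB_self X hX]; positivity

lemma auxB_self_eq_zero (X : E →L[ℂ] E) (hX : ∀ x y, inner ℂ (X x) y = -inner ℂ x (X y))
    (h : auxB X X = 0) : X = 0 := by
  rw [auxB_self X hX, Finset.sum_eq_zero_iff_of_nonneg (fun i _ => by positivity)] at h
  have : (X : E →ₗ[ℂ] E) = 0 := by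
    refine (stdOrthonormalBasis ℂ E).toBasis.ext fun i => ?_
    simpa using h i (Finset.mem_univ i)
  ext x
  exact congrArg (fun f : E →ₗ[ℂ] E => f x) this

lemma auxB_conj (k l X Y : E →L[ℂ] E) (hkl : k * l = 1) :
    auxB (l * X * k) (l * Y * k) = auxB X Y := by
  have hkl' : (k : E →ₗ[ℂ] E) * (l : E →ₗ[ℂ] E) = 1 := by
    ext x; exact congrArg (fun f : E →L[ℂ] E => f x) hkl
  simp only [auxB]
  congr 2
  have : ((l * X * k : E →L[ℂ] E) : E →ₗ[ℂ] E) * ((l * Y * k : E →L[ℂ] E) : E →ₗ[ℂ] E)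
      = (l : E →ₗ[ℂ] E) * ((X : E →ₗ[ℂ] E) * (Y : E →ₗ[ℂ] E) * (k : E →ₗ[ℂ] E)) := by
    calc _ = (l : E →ₗ[ℂ] E) * ((X : E →ₗ[ℂ] E) * ((k : E →ₗ[ℂ] E) * (l : E →ₗ[ℂ] E)) *
          (Y : E →ₗ[ℂ] E) * (k : E →ₗ[ℂ] E)) := rfl
      _ = _ := by rw [hkl', mul_one]
  rw [this, LinearMap.trace_mul_comm, mul_assoc, hkl', mul_one]

/-- Existence of the moment map with values in `V`. -/
lemma aux_exists_mu (V : Submodule ℝ (E →L[ℂ] E))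
    (hsk : ∀ X ∈ V, ∀ x y, inner ℂ (X x) y = -inner ℂ x (X y)) :
    ∃ μ : E → (E →L[ℂ] E), (∀ w, μ w ∈ V) ∧
      ∀ w, ∀ X ∈ V, auxB (μ w) X = (inner ℂ w (X w)).im := by
  have : FiniteDimensional ℝ E := FiniteDimensional.complexToReal E
  have : FiniteDimensional ℝ (E →L[ℂ] E) := FiniteDimensional.complexToReal _
  let B : LinearMap.BilinForm ℝ V := LinearMap.mk₂ ℝ (fun X Y => auxB X.1 Y.1)
    (fun _ _ _ => auxB_add_left _ _ _) (fun _ _ _ => auxB_smul_left _ _ _)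
    (fun _ _ _ => auxB_add_right _ _ _) (fun _ _ _ => auxB_smul_right _ _ _)
  have hB : B.Nondegenerate := by
    constructor
    · intro X hX
      exact Subtype.ext (auxB_self_eq_zero X.1 (hsk _ X.2) (hX X))
    · intro X hX
      exact Subtype.ext (auxB_self_eq_zero X.1 (hsk _ X.2) (hX X))
  let f : E → Module.Dual ℝ V := fun w =>
    { toFun := fun X => (inner ℂ w (X.1 w)).im
      map_add' := fun X Y => by simp
      map_smul' := fun c X => by
        have : (c • X.1) w = (c : ℂ) • X.1 w := by simp
        simp }
  refine ⟨fun w => ((B.toDual hB).symm (f w)).1, fun w => Subtype.property _, fun w X hX => ?_⟩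
  exact LinearMap.BilinForm.apply_toDual_symm_apply (B := B) (hB := hB) (f := f w) (v := ⟨X, hX⟩)

lemma aux_real_sep {F : Type*} [NormedAddCommGroup F] [InnerProductSpace ℝ F]
    [FiniteDimensional ℝ F] (P : Submodule ℝ F) (a : F)
    (h : ∀ w, (∀ x ∈ P, inner ℝ w x = 0) → inner ℝ w a = 0) : a ∈ P := by
  rw [← Submodule.orthogonal_orthogonal P, Submodule.mem_orthogonal]
  intro w hw
  exact h w ((Submodule.mem_orthogonal' _ _).1 hw)

lemma aux_sep (P : Submodule ℝ E) (a : E)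
    (h : ∀ w, (∀ x ∈ P, (inner ℂ w x).re = 0) → (inner ℂ w a).re = 0) : a ∈ P := 
  @aux_real_sep E _ (InnerProductSpace.rclikeToReal ℂ E) (FiniteDimensional.complexToReal E) P a h

lemma aux_norm_sq (x : E) : inner ℂ x x = ((‖x‖ ^ 2 : ℝ) : ℂ) := by
  rw [inner_self_eq_norm_sq_to_K]; simp

lemma aux_mul_apply (X Y : E →L[ℂ] E) (x : E) : (X * Y) x = X (Y x) := rfl

/-- The real span of `V z` and `z` is everything (stated via orthogonality). -/
theorem aux_core (V : Submodule ℝ (E →L[ℂ] E))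
    (hsk : ∀ X ∈ V, ∀ x y, inner ℂ (X x) y = -inner ℂ x (X y))
    (hbr : ∀ X ∈ V, ∀ Y ∈ V, X * Y - Y * X ∈ V)
    (hns : ∃ X ∈ V, ∀ c : ℂ, X ≠ c • (1 : E →L[ℂ] E))
    (htr : ∀ z w : E, ‖z‖ = 1 → ‖w‖ = 1 → ∃ k l : E →L[ℂ] E, k * l = 1 ∧ l * k = 1 ∧
      (∀ x y, inner ℂ (k x) y = inner ℂ x (l y)) ∧ k z = w ∧
      (∀ X ∈ V, l * X * k ∈ V) ∧ (∀ X ∈ V, k * X * l ∈ V))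
    (z v : E) (hz : ‖z‖ = 1) (hv : ∀ X ∈ V, (inner ℂ v (X z)).re = 0)
    (hvz : (inner ℂ z v).re = 0) : v = 0 := by
  obtain ⟨μ, hμV, hμ⟩ := aux_exists_mu V hsk
  -- equality in `V` can be tested with the form
  have hext : ∀ X ∈ V, ∀ Y ∈ V, (∀ W ∈ V, auxB X W = auxB Y W) → X = Y := by
    intro X hX Y hY h
    have h0 : auxB (X + (-1 : ℝ) • Y) (X + (-1 : ℝ) • Y) = 0 := by
      have hm : X + (-1 : ℝ) • Y ∈ V := V.add_mem hX (V.smul_mem _ hY)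
      rw [auxB_add_left, auxB_smul_left, h _ hm]; ring
    have hm : X + (-1 : ℝ) • Y ∈ V := V.add_mem hX (V.smul_mem _ hY)
    have := auxB_self_eq_zero _ (hsk _ hm) h0
    rw [neg_one_smul, ← sub_eq_add_neg, sub_eq_zero] at this
    exact this
  -- equivariance of the norm of `μ`
  have hqk : ∀ z w : E, ‖z‖ = 1 → ‖w‖ = 1 → auxB (μ w) (μ w) = auxB (μ z) (μ z) := by
    intro z w hz hw
    obtain ⟨k, l, hkl, hlk, hadj, hkz, hl, hk⟩ := htr z w hz hw
    have h1 : μ w = k * μ z * l := by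
      refine hext _ (hμV w) _ (hk _ (hμV z)) fun X hX => ?_
      have h2 : auxB (k * μ z * l) X = auxB (μ z) (l * X * k) := by
        rw [← auxB_conj k l (k * μ z * l) X hkl]
        have : l * (k * μ z * l) * k = (l * k) * μ z * (l * k) := by simp only [mul_assoc]
        rw [this, hlk, one_mul, mul_one]
      rw [h2, hμ z _ (hl X hX), hμ w X hX, ← hkz, hadj]
      rfl
    have h3 : auxB (μ w) (μ w) = (inner ℂ w (μ w w)).im := hμ w _ (hμV w)
    rw [h3, h1]
    have h4 : auxB (μ z) (μ z) = (inner ℂ z (μ z z)).im := hμ z _ (hμV z)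
    have hlk' : ∀ x, l (k x) = x := fun x => congrArg (fun f : E →L[ℂ] E => f x) hlk
    rw [h4, ← hkz, hadj]
    simp only [aux_mul_apply, hlk']
  have hμs : ∀ (a : ℝ) (w : E), μ ((a : ℂ) • w) = (a ^ 2) • μ w := by
    intro a w
    refine hext _ (hμV _) _ (V.smul_mem _ (hμV w)) fun X hX => ?_
    rw [hμ _ _ hX, auxB_smul_left, hμ _ _ hX, map_smul, inner_smul_left, inner_smul_right,
      Complex.conj_ofReal, Complex.im_ofReal_mul, Complex.im_ofReal_mul]
    ring
  set M := μ z with hM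
  set c := auxB M M with hc
  have hMV : M ∈ V := hμV z
  have hq : ∀ w, auxB (μ w) (μ w) = c * ‖w‖ ^ 4 := by
    intro w
    by_cases hw : w = 0
    · subst hw
      rw [hμ _ _ (hμV 0)]; simp
    · have hw' : ‖w‖ ≠ 0 := norm_ne_zero_iff.mpr hw
      have h1 : w = ((‖w‖ : ℝ) : ℂ) • (((‖w‖⁻¹ : ℝ) : ℂ) • w) := by
        rw [smul_smul, ← Complex.ofReal_mul, mul_inv_cancel₀ hw', Complex.ofReal_one, one_smul]
      have h2 : ‖((‖w‖⁻¹ : ℝ) : ℂ) • w‖ = 1 := by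
        rw [norm_smul, Complex.norm_real, norm_inv, norm_norm, inv_mul_cancel₀ hw']
      have h3 := hqk z _ hz h2
      conv_lhs => rw [h1]
      rw [hμs, auxB_smul_left, auxB_smul_right, h3]
      ring
  -- expansion of the form
  have hBsub : ∀ (w : E), auxB (μ w + (-‖w‖ ^ 2) • M) (μ w + (-‖w‖ ^ 2) • M)
      = 2 * ‖w‖ ^ 2 * (c * ‖w‖ ^ 2 - (inner ℂ w (M w)).im) := by
    intro w
    rw [auxB_add_left, auxB_add_right, auxB_add_right, auxB_smul_left, auxB_smul_left,
      auxB_smul_right, auxB_smul_right, hq, auxB_symm M (μ w), hμ w M hMV, ← hc]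
    ring
  have hmemsub : ∀ w, μ w + (-‖w‖ ^ 2) • M ∈ V := fun w =>
    V.add_mem (hμV w) (V.smul_mem _ hMV)
  have hle : ∀ w, (inner ℂ w (M w)).im ≤ c * ‖w‖ ^ 2 := by
    intro w
    by_cases hw : w = 0
    · subst hw; simp
    · have h := auxB_self_nonneg _ (hsk _ (hmemsub w))
      rw [hBsub] at h
      have hw' : 0 < 2 * ‖w‖ ^ 2 := by positivity
      have := nonneg_of_mul_nonneg_right h hw'
      linarith
  have heq : ∀ w, (inner ℂ w (M w)).im = c * ‖w‖ ^ 2 → μ w = (‖w‖ ^ 2) • M := by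
    intro w hw
    have h0 : auxB (μ w + (-‖w‖ ^ 2) • M) (μ w + (-‖w‖ ^ 2) • M) = 0 := by
      rw [hBsub, hw]; ring
    have := auxB_self_eq_zero _ (hsk _ (hmemsub w)) h0
    rw [neg_smul, ← sub_eq_add_neg, sub_eq_zero] at this
    exact this
  have hMskew := hsk M hMV
  -- maximality implies eigenvector
  have heig : ∀ w, (inner ℂ w (M w)).im = c * ‖w‖ ^ 2 → M w = (Complex.I * c) • w := by
    intro w hw
    let S : E →L[ℂ] E := (c : ℂ) • (1 : E →L[ℂ] E) + Complex.I • M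
    have hS : ∀ x, S x = (c : ℂ) • x + Complex.I • M x := fun x => by simp [S]
    have hre : ∀ x, (inner ℂ x (S x)).re = c * ‖x‖ ^ 2 - (inner ℂ x (M x)).im := by
      intro x
      rw [hS, inner_add_right, inner_smul_right, inner_smul_right, aux_norm_sq]
      simp [← Complex.ofReal_pow]
      ring
    have := aux_psd_ker S (by
      intro x y
      rw [hS, hS, inner_add_left, inner_add_right, inner_smul_left, inner_smul_left,
        inner_smul_right, inner_smul_right, hMskew]
      simp) (fun x => by rw [hre]; linarith [hle x]) w (by rw [hre]; linarith)
    rw [hS] at this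
    have h2 : M w = -Complex.I • (Complex.I • M w) := by
      rw [smul_smul]; simp
    rw [h2, eq_neg_of_add_eq_zero_right this, mul_smul]
    simp
  have heig' : ∀ w, M w = (Complex.I * c) • w → (inner ℂ w (M w)).im = c * ‖w‖ ^ 2 := by
    intro w hw
    rw [hw, inner_smul_right, aux_norm_sq]
    simp [← Complex.ofReal_pow]
  have hMz : M z = (Complex.I * c) • z := by
    apply heig
    rw [← hμ z M hMV, ← hM, ← hc, hz]; ring
  -- purely imaginary diagonal
  have hdiag : ∀ X ∈ V, ∀ x, inner ℂ x (X x) = Complex.I * ((inner ℂ x (X x)).im : ℂ) := by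
    intro X hX x
    have h1 := hsk X hX x x
    rw [← inner_conj_symm] at h1
    have h2 := congrArg Complex.re h1
    simp only [Complex.conj_re, Complex.neg_re] at h2
    apply Complex.ext <;> simp
    linarith
  have hscal : ∀ X ∈ V, ∀ b : ℝ, (∀ x, (inner ℂ x (X x)).im = b * ‖x‖ ^ 2) →
      X = (Complex.I * b) • (1 : E →L[ℂ] E) := by
    intro X hX b h
    have h0 : ((X - (Complex.I * b) • (1 : E →L[ℂ] E) : E →L[ℂ] E) : E →ₗ[ℂ] E) = 0 := by
      rw [← inner_map_self_eq_zero]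
      intro x
      rw [← inner_conj_symm]
      simp only [ContinuousLinearMap.coe_coe, sub_apply,
        smul_apply, one_apply_eq_self, inner_sub_right,
        inner_smul_right]
      rw [hdiag X hX x, h, aux_norm_sq]
      push_cast
      rw [← map_zero (starRingEnd ℂ)]
      congr 1
      ring
    rw [← sub_eq_zero]
    ext x
    exact congrArg (fun f : E →ₗ[ℂ] E => f x) h0
  obtain ⟨X0, hX0, hX0s⟩ := hns
  have hc0 : c ≠ 0 := by
    intro h0
    have hμ0 : ∀ w, μ w = 0 := fun w =>
      auxB_self_eq_zero _ (hsk _ (hμV w)) (by rw [hq, h0, zero_mul])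
    refine hX0s _ (hscal X0 hX0 0 fun x => ?_)
    rw [← hμ x X0 hX0, hμ0]
    simp [auxB]
  -- cross terms
  have hcross : ∀ X ∈ V, ∀ x y, (inner ℂ (x + y) (X (x + y))).im
      = (inner ℂ x (X x)).im + (inner ℂ y (X y)).im + 2 * (inner ℂ y (X x)).im := by
    intro X hX x y
    have h1 : (inner ℂ x (X y)).im = (inner ℂ y (X x)).im := by
      have := hsk X hX x y
      rw [← inner_conj_symm] at this
      have h2 := congrArg Complex.im this
      simp only [Complex.conj_im, Complex.neg_im] at h2
      linarith
    simp only [map_add, inner_add_left, inner_add_right, Complex.add_im]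
    rw [h1]; ring
  -- the orthogonality lemma on the eigenspace
  have horth : ∀ x y, M x = (Complex.I * c) • x → M y = (Complex.I * c) • y →
      inner ℂ x y = 0 → ∀ X ∈ V, inner ℂ y (X x) = 0 := by
    have haux : ∀ x y, M x = (Complex.I * c) • x → M y = (Complex.I * c) • y →
      inner ℂ x y = 0 → ∀ X ∈ V, (inner ℂ y (X x)).im = 0 := by
      intro x y hx hy hxy X hX
      have hxy' : M (x + y) = (Complex.I * c) • (x + y) := by rw [map_add, hx, hy, smul_add]
      have e1 := heq x (heig' x hx)
      have e2 := heq y (heig' y hy)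
      have e3 := heq _ (heig' _ hxy')
      have hn : ‖x + y‖ ^ 2 = ‖x‖ ^ 2 + ‖y‖ ^ 2 := by
        have := norm_add_sq (𝕜 := ℂ) x y
        rw [hxy] at this; simpa using this
      have h := hcross X hX x y
      rw [← hμ _ X hX, ← hμ _ X hX, ← hμ _ X hX, e1, e2, e3, hn, auxB_smul_left,
        auxB_smul_left, auxB_smul_left] at h
      linarith
    intro x y hx hy hxy X hX
    have h1 := haux x y hx hy hxy X hX
    have h2 := haux x (Complex.I • y) hx (by rw [map_smul, hy, smul_comm])
      (by rw [inner_smul_right, hxy, mul_zero]) X hX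
    rw [inner_smul_left] at h2
    apply Complex.ext
    · simpa using h2
    · simpa using h1
  -- step 2
  have hstep2 : ∀ z' : E, ‖z'‖ = 1 → M z' = (Complex.I * c) • z' → ∀ w,
      (∀ X ∈ V, (inner ℂ w (X z')).re = 0) → (inner ℂ z' w).re = 0 →
      M w = (Complex.I * c) • w ∧ inner ℂ z' w = 0 := by
    intro z' hz' hMz' w hw hzw
    have him : (inner ℂ z' w).im = 0 := by
      have h1 := hw M hMV
      rw [hMz', inner_smul_right] at h1
      simp [hc0] at h1
      rw [← inner_conj_symm, Complex.conj_im, h1, neg_zero]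
    have h0 : inner ℂ z' w = 0 := Complex.ext (by simpa using hzw) (by simpa using him)
    refine ⟨?_, h0⟩
    have hμz' : μ z' = M := by
      rw [heq z' (heig' z' hMz'), hz']; simp
    set w' := Complex.I • w with hw'
    have hadd : μ (z' + w') = M + μ w' := by
      refine hext _ (hμV _) _ (V.add_mem hMV (hμV _)) fun X hX => ?_
      rw [hμ _ X hX, hcross X hX, auxB_add_left, hμ w' X hX, ← hμ z' X hX, hμz']
      have : (inner ℂ w' (X z')).im = 0 := by
        rw [hw', inner_smul_left]
        simpa using hw X hX
      rw [this]; ring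
    have hn : ‖z' + w'‖ ^ 2 = 1 + ‖w'‖ ^ 2 := by
      have := norm_add_sq (𝕜 := ℂ) z' w'
      rw [hw', inner_smul_right, h0, ← hw', hz'] at this; simpa using this
    have hq1 := hq (z' + w')
    rw [hadd, auxB_add_left, auxB_add_right, auxB_add_right, hq w', auxB_symm M (μ w'),
      hμ w' M hMV, ← hc, show ‖z' + w'‖ ^ 4 = (‖z' + w'‖ ^ 2) ^ 2 by ring, hn] at hq1
    have h3 := heig w' (by nlinarith)
    rw [hw', map_smul, smul_comm] at h3
    exact smul_right_injective E Complex.I_ne_zero h3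
  by_contra hv0
  obtain ⟨hMv, hzv⟩ := hstep2 z hz hMz v hv hvz
  -- normalise
  obtain ⟨y, hy, hMy, hzy⟩ : ∃ y : E, ‖y‖ = 1 ∧ M y = (Complex.I * c) • y ∧ inner ℂ z y = 0 := by
    refine ⟨((‖v‖⁻¹ : ℝ) : ℂ) • v, ?_, ?_, ?_⟩
    · rw [norm_smul, Complex.norm_real, norm_inv, norm_norm,
        inv_mul_cancel₀ (norm_ne_zero_iff.mpr hv0)]
    · rw [map_smul, hMv, smul_comm]
    · rw [inner_smul_right, hzv, mul_zero]
  -- surjectivity onto the orthogonal complement of the eigenspace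
  have hsurj : ∀ z' : E, ‖z'‖ = 1 → M z' = (Complex.I * c) • z' → ∀ a : E,
      (∀ e, M e = (Complex.I * c) • e → inner ℂ e a = 0) → ∃ X ∈ V, X z' = a := by
    intro z' hz' hMz' a ha
    let ev : (E →L[ℂ] E) →ₗ[ℝ] E :=
      { toFun := fun X => X z', map_add' := fun _ _ => rfl, map_smul' := fun _ _ => rfl }
    let P : Submodule ℝ E := V.map ev
    have hmem : a ∈ P := by
      refine aux_sep P a fun w hw => ?_
      have hw1 : ∀ X ∈ V, (inner ℂ w (X z')).re = 0 := fun X hX =>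
        hw (X z') ⟨X, hX, rfl⟩
      set r := (inner ℂ z' w).re
      have hw2 := hstep2 z' hz' hMz' (w - (r : ℂ) • z') (by
        intro X hX
        rw [inner_sub_left, inner_smul_left, hdiag X hX z']
        simp [hw1 X hX]) (by
        rw [inner_sub_right, inner_smul_right, aux_norm_sq, hz']
        simp [r])
      have hMw : M w = (Complex.I * c) • w := by
        have h1 := hw2.1
        rw [map_sub, smul_sub, map_smul, hMz', smul_comm] at h1
        exact sub_left_injective h1
      rw [ha w hMw]; simp
    obtain ⟨X, hX, hXa⟩ := hmem
    exact ⟨X, hX, hXa⟩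
  -- the eigenspace
  let Eg : Submodule ℂ E := LinearMap.ker ((M : E →ₗ[ℂ] E) - (Complex.I * c) • LinearMap.id)
  have hEg : ∀ x, x ∈ Eg ↔ M x = (Complex.I * c) • x := fun x => by
    simp [Eg, LinearMap.mem_ker, sub_eq_zero]
  have hEgtop : Eg ≠ ⊤ := by
    intro htop
    have hall : ∀ x, M x = (Complex.I * c) • x := fun x => (hEg x).1 (htop ▸ Submodule.mem_top)
    refine hX0s _ (hscal X0 hX0 (auxB M X0) fun x => ?_)
    rw [← hμ x X0 hX0, heq x (heig' x (hall x)), auxB_smul_left]; ring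
  have hinv : ∀ x ∈ Egᗮ, M x ∈ Egᗮ := by
    intro x hx
    rw [Submodule.mem_orthogonal] at hx ⊢
    intro e he
    have h1 := hMskew e x
    rw [(hEg e).1 he, inner_smul_left, hx e he, mul_zero] at h1
    exact neg_eq_zero.mp h1.symm
  obtain ⟨u, huE, hu0, κ, hMu⟩ : ∃ u ∈ Egᗮ, u ≠ 0 ∧ ∃ κ : ℂ, M u = κ • u := by
    have hnt : Nontrivial Egᗮ := by
      rw [Submodule.nontrivial_iff_ne_bot, Ne, Submodule.orthogonal_eq_bot_iff]
      exact hEgtop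
    obtain ⟨κ, hκ⟩ := Module.End.exists_eigenvalue
      ((M : E →ₗ[ℂ] E).restrict (p := Egᗮ) (q := Egᗮ) hinv)
    obtain ⟨u, hu⟩ := hκ.exists_hasEigenvector
    refine ⟨u.1, u.2, fun h => hu.2 (Subtype.ext h), κ, ?_⟩
    exact congrArg Subtype.val hu.apply_eq_smul
  have horthE : ∀ a ∈ Egᗮ, ∀ e, M e = (Complex.I * c) • e → inner ℂ e a = 0 := fun a ha e he =>
    (Submodule.mem_orthogonal _ _).1 ha e ((hEg e).2 he)
  -- `κ = I (c - q)` with `q > 0`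
  obtain ⟨q, hq0, hκ⟩ : ∃ q : ℝ, 0 < q ∧ κ = Complex.I * c - Complex.I * q := by
    have h1 := hdiag M hMV u
    have hun : (0 : ℝ) < ‖u‖ ^ 2 := by positivity
    rw [hMu, inner_smul_right, aux_norm_sq] at h1
    have h2 := hle u
    rw [hMu, inner_smul_right, aux_norm_sq] at h2
    have him : (κ * ((‖u‖ ^ 2 : ℝ) : ℂ)).im = κ.im * ‖u‖ ^ 2 := by
      rw [mul_comm, Complex.im_ofReal_mul]; ring
    have hre : (κ * ((‖u‖ ^ 2 : ℝ) : ℂ)).re = κ.re * ‖u‖ ^ 2 := by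
      rw [mul_comm, Complex.re_ofReal_mul]; ring
    rw [him] at h2
    have h3 := congrArg Complex.re h1
    rw [hre] at h3
    simp only [Complex.mul_re, Complex.I_re, Complex.ofReal_im, zero_mul, Complex.I_im,
      mul_zero, sub_zero] at h3
    have hκre : κ.re = 0 := by
      rcases mul_eq_zero.mp h3 with h | h
      · exact h
      · exact absurd h hun.ne'
    have hκle : κ.im ≤ c := le_of_mul_le_mul_right h2 hun
    refine ⟨c - κ.im, ?_, ?_⟩
    · rcases hκle.lt_or_eq with h | h
      · linarith
      · exfalso
        apply hu0
        have hκ' : κ = Complex.I * c := by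
          apply Complex.ext <;> simp [hκre, h]
        rw [hκ'] at hMu
        have := horthE u huE u hMu
        exact inner_self_eq_zero.mp this
    · apply Complex.ext <;> simp [hκre]
  obtain ⟨X, hX, hXz⟩ := hsurj z hz hMz u (horthE u huE)
  -- commutator identity
  have hC : ∀ X ∈ V, ∀ Y ∈ V, inner ℂ (X y) (Y z) = inner ℂ (Y y) (X z) := by
    intro X hX Y hY
    have h := horth z y hMz hMy hzy _ (hbr X hX Y hY)
    simp only [sub_apply, aux_mul_apply, inner_sub_right] at h
    rw [hsk X hX, hsk Y hY]
    rw [sub_eq_zero] at h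
    rw [h]
  set α := inner ℂ y (X y) with hα
  set u' := X y - α • y with hu'
  have hXy : X y = u' + α • y := by rw [hu']; abel
  have hu'E : u' ∈ Egᗮ := by
    rw [Submodule.mem_orthogonal]
    intro e he
    have hMe := (hEg e).1 he
    -- decompose `e`
    set β := inner ℂ y e with hβ
    have hyy : inner ℂ y y = 1 := by rw [aux_norm_sq, hy]; simp
    have h1 : inner ℂ y (e - β • y) = 0 := by
      rw [inner_sub_right, inner_smul_right, hyy, ← hβ]; ring
    have h2 := horth y (e - β • y) hMy (by rw [map_sub, map_smul, hMe, hMy, smul_sub, smul_comm])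
      h1 X hX
    have h3 : inner ℂ (e - β • y) y = 0 := by
      rw [← inner_conj_symm, h1, map_zero]
    have h4 : e = (e - β • y) + β • y := by abel
    rw [h4, inner_add_left, hu', inner_sub_right, inner_sub_right, inner_smul_right,
      inner_smul_right, inner_smul_left, inner_smul_left, h2, h3, hyy, ← hα]
    ring
  set D : E → E := fun x => M x - (Complex.I * c) • x with hD
  have hDu : D u = (-(Complex.I * q)) • u := by
    simp only [hD]; rw [hMu, hκ, ← sub_smul]; congr 1; ring
  have hDE : ∀ x ∈ Egᗮ, D x ∈ Egᗮ := fun x hx =>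
    Submodule.sub_mem _ (hinv x hx) (Submodule.smul_mem _ _ hx)
  set X1 := M * X - X * M with hX1
  have hX1V : X1 ∈ V := hbr M hMV X hX
  have hX1z : X1 z = (-(Complex.I * q)) • u := by
    rw [← hDu]
    simp only [hX1, hD, sub_apply, aux_mul_apply, hMz,
      map_smul, hXz]
  have hX1y : X1 y = D u' := by
    simp only [hX1, hD, sub_apply, aux_mul_apply, hMy,
      map_smul, hXy, map_add, smul_add]
    rw [smul_comm α]; abel
  set X2 := M * X1 - X1 * M with hX2
  have hX2V : X2 ∈ V := hbr M hMV X1 hX1V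
  have hX2z : X2 z = (-(q ^ 2 : ℂ)) • u := by
    have : X2 z = (-(Complex.I * q)) • D u := by
      simp only [hX2, hD, sub_apply, aux_mul_apply, hMz,
        map_smul, hX1z]
      rw [smul_sub, smul_comm (Complex.I * (c : ℂ))]
    rw [this, hDu, smul_smul]
    congr 1
    linear_combination (q : ℂ) ^ 2 * Complex.I_sq
  have hX2y : X2 y = D (D u') := by
    simp only [hX2, sub_apply, aux_mul_apply, hMy,
      map_smul, hX1y]
    rfl
  set W := X2 + (q ^ 2 : ℝ) • X with hW
  have hWV : W ∈ V := V.add_mem hX2V (V.smul_mem _ hX)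
  have hWz : W z = 0 := by
    have : ((q ^ 2 : ℝ) • X) z = (q ^ 2 : ℂ) • u := by
      rw [smul_apply, hXz, ← Complex.ofReal_pow]; exact (Complex.coe_smul _ _).symm
    rw [hW, add_apply, this, hX2z, ← add_smul]; simp
  have hWy : W y = (D (D u') + (q ^ 2 : ℂ) • u') + ((q ^ 2 : ℂ) * α) • y := by
    have : ((q ^ 2 : ℝ) • X) y = (q ^ 2 : ℂ) • X y := by
      rw [smul_apply, ← Complex.ofReal_pow]; exact (Complex.coe_smul _ _).symm
    rw [hW, add_apply, this, hX2y, hXy, smul_add, smul_smul, add_assoc]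
  have hmem : D (D u') + (q ^ 2 : ℂ) • u' ∈ Egᗮ :=
    Submodule.add_mem _ (hDE _ (hDE _ hu'E)) (Submodule.smul_mem _ _ hu'E)
  have hzero : D (D u') + (q ^ 2 : ℂ) • u' = 0 := by
    obtain ⟨Y, hY, hYz⟩ := hsurj z hz hMz _ (horthE _ hmem)
    have h := hC W hWV Y hY
    rw [hWz, inner_zero_right, hYz, hWy, inner_add_left, inner_smul_left,
      horthE _ hmem y hMy, mul_zero, add_zero] at h
    exact inner_self_eq_zero.mp h
  have hDu' : D u' = (-(Complex.I * q)) • u' := by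
    set x := D u' + (Complex.I * q) • u' with hx
    have hMx : M x = (Complex.I * ((c + q : ℝ) : ℂ)) • x := by
      have h1 : D x = (Complex.I * q) • x := by
        have hlin : D x = D (D u') + (Complex.I * q) • D u' := by
          simp only [hx, hD, map_add, map_sub, map_smul, smul_add, smul_sub]
          rw [smul_comm (Complex.I * (q : ℂ)) (Complex.I * (c : ℂ)) u']
          abel
        rw [hlin, eq_neg_of_add_eq_zero_left hzero, hx, smul_add, smul_smul, add_comm]
        congr 1
        rw [← neg_smul]
        congr 1
        linear_combination - (q : ℂ) ^ 2 * Complex.I_sq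
      have h2 : M x = D x + (Complex.I * c) • x := by simp [hD]
      rw [h2, h1, ← add_smul]
      congr 1
      push_cast; ring
    have h3 := hle x
    rw [hMx, inner_smul_right, aux_norm_sq] at h3
    have h4 : (Complex.I * ((c + q : ℝ) : ℂ) * ((‖x‖ ^ 2 : ℝ) : ℂ)).im = (c + q) * ‖x‖ ^ 2 := by
      rw [mul_assoc, ← Complex.ofReal_mul, Complex.I_mul_im, Complex.ofReal_re]
    rw [h4] at h3
    have h5 : ‖x‖ ^ 2 ≤ 0 := by nlinarith
    have h6 : x = 0 := by
      have : ‖x‖ = 0 := by nlinarith [norm_nonneg x]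
      exact norm_eq_zero.mp this
    rw [neg_smul]
    exact eq_neg_of_add_eq_zero_left h6
  have hfinal : ∀ Y ∈ V, inner ℂ (Y y) u = 0 := by
    intro Y hY
    have h1 := hC X1 hX1V Y hY
    rw [hX1y, hDu', hX1z, inner_smul_left, inner_smul_right] at h1
    have h2 := hC X hX Y hY
    rw [hXy, hXz, inner_add_left, inner_smul_left, horth z y hMz hMy hzy Y hY, mul_zero,
      add_zero] at h2
    rw [h2] at h1
    simp only [map_neg, map_mul, Complex.conj_I, Complex.conj_ofReal] at h1
    have h3 : (2 * Complex.I * q) * inner ℂ (Y y) u = 0 := by linear_combination h1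
    rcases mul_eq_zero.mp h3 with h | h
    · exfalso
      have : (q : ℂ) ≠ 0 := by exact_mod_cast hq0.ne'
      simp [this] at h
    · exact h
  obtain ⟨Y, hY, hYy⟩ := hsurj y hy hMy u (horthE u huE)
  have := hfinal Y hY
  rw [hYy] at this
  exact hu0 (inner_self_eq_zero.mp this)

end PartA

section PartB

set_option linter.unusedSectionVars false

open Filter Topology

lemma aux_krener {E : Type*} [NormedAddCommGroup E] [NormedSpace ℝ E] [FiniteDimensional ℝ E]
    {ι : Type*} (S : Set E) (s0 : E) (hs0 : s0 ∈ S)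
    (C : ι → ℝ → (E →L[ℝ] E)) (D : ι → (E →L[ℝ] E))
    (hC : ∀ i, HasStrictDerivAt (C i) (C i 0 * D i) 0)
    (hinj : ∀ i, Function.Injective (C i 0))
    (hS : ∀ i, ∀ᶠ τ in 𝓝 (0 : ℝ), ∀ s ∈ S, C i τ s ∈ S) :
    ∃ (E' : Type) (_ : NormedAddCommGroup E') (_ : NormedSpace ℝ E') (_ : CompleteSpace E')
      (Φ : E' → E) (Φ' : E' →L[ℝ] E), HasStrictFDerivAt Φ Φ' 0 ∧ (∀ᶠ t in 𝓝 0, Φ t ∈ S) ∧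
      ∀ i, D i (Φ 0) ∈ LinearMap.range (Φ' : E' →ₗ[ℝ] E) := by
  let Q : Set ℕ := {k | ∃ (E' : Type) (_ : NormedAddCommGroup E') (_ : NormedSpace ℝ E')
      (_ : CompleteSpace E')
      (Φ : E' → E) (Φ' : E' →L[ℝ] E), HasStrictFDerivAt Φ Φ' 0 ∧ (∀ᶠ t in 𝓝 0, Φ t ∈ S) ∧
      Module.finrank ℝ (LinearMap.range (Φ' : E' →ₗ[ℝ] E)) = k}
  have hQne : Q.Nonempty := ⟨_, ℝ, inferInstance, inferInstance, inferInstance, fun _ => s0, 0,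
    hasStrictFDerivAt_const _ _, Eventually.of_forall fun _ => hs0, rfl⟩
  have hQb : BddAbove Q := by
    refine ⟨Module.finrank ℝ E, ?_⟩
    rintro k ⟨E', _, _, _, Φ, Φ', _, _, rfl⟩
    exact Submodule.finrank_le _
  obtain ⟨E', i1, i2, i3, Φ, Φ', hΦ, hΦS, hk⟩ := Nat.sSup_mem hQne hQb
  refine ⟨E', i1, i2, i3, Φ, Φ', hΦ, hΦS, fun i => ?_⟩
  set A := LinearMap.range (Φ' : E' →ₗ[ℝ] E) with hA
  set p := Φ 0 with hp
  by_contra hnot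
  let Ψ : E' × ℝ → E := fun x => C i x.2 (Φ x.1)
  have h1 : HasStrictFDerivAt (fun x : E' × ℝ => Φ x.1)
      (Φ'.comp (ContinuousLinearMap.fst ℝ E' ℝ)) (0 : E' × ℝ) :=
    HasStrictFDerivAt.comp (0 : E' × ℝ) (g := Φ) (f := Prod.fst) hΦ hasStrictFDerivAt_fst
  have h2 : HasStrictFDerivAt (fun x : E' × ℝ => C i x.2)
      ((ContinuousLinearMap.toSpanSingleton ℝ (C i 0 * D i)).comp
        (ContinuousLinearMap.snd ℝ E' ℝ)) (0 : E' × ℝ) :=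
    HasStrictFDerivAt.comp (0 : E' × ℝ) (g := C i) (f := Prod.snd)
      (hC i).hasStrictFDerivAt hasStrictFDerivAt_snd
  have h3 := h2.clm_apply h1
  have hΨS : ∀ᶠ x in 𝓝 (0 : E' × ℝ), Ψ x ∈ S := by
    have e1 : ∀ᶠ x in 𝓝 (0 : E' × ℝ), Φ x.1 ∈ S :=
      (continuous_fst.tendsto (0 : E' × ℝ)).eventually hΦS
    have e2 : ∀ᶠ x in 𝓝 (0 : E' × ℝ), ∀ s ∈ S, C i x.2 s ∈ S :=
      (continuous_snd.tendsto (0 : E' × ℝ)).eventually (hS i)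
    filter_upwards [e1, e2] with x h1 h2 using h2 _ h1
  have hle := le_csSup hQb (show _ ∈ Q from
    ⟨E' × ℝ, inferInstance, inferInstance, inferInstance, Ψ, _, h3, hΨS, rfl⟩)
  rw [← hk] at hle
  have hsub : (A ⊔ Submodule.span ℝ {D i p}).map (C i 0 : E →ₗ[ℝ] E) ≤ LinearMap.range
      (((C i (0 : E' × ℝ).2).comp (Φ'.comp (ContinuousLinearMap.fst ℝ E' ℝ)) +
        ((ContinuousLinearMap.toSpanSingleton ℝ (C i 0 * D i)).comp
        (ContinuousLinearMap.snd ℝ E' ℝ)).flip (Φ (0 : E' × ℝ).1) : E' × ℝ →L[ℝ] E) :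
          E' × ℝ →ₗ[ℝ] E) := by
    rw [Submodule.map_sup, sup_le_iff]
    constructor
    · rintro _ ⟨_, ⟨t, rfl⟩, rfl⟩
      exact ⟨(t, 0), by simp⟩
    · rw [Submodule.map_span, Submodule.span_le]
      rintro _ ⟨_, rfl, rfl⟩
      exact ⟨(0, 1), by simp [hp]⟩
  have h4 := Submodule.finrank_mono hsub
  rw [← LinearEquiv.finrank_eq (Submodule.equivMapOfInjective (C i 0 : E →ₗ[ℝ] E) (hinj i)
    (A ⊔ Submodule.span ℝ {D i p}))] at h4
  have h5 : A < A ⊔ Submodule.span ℝ {D i p} := by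
    rw [left_lt_sup]
    intro h
    exact hnot (h (Submodule.mem_span_singleton_self _))
  have h6 := Submodule.finrank_lt_finrank_of_lt h5
  omega

lemma aux_open {E : Type*} [NormedAddCommGroup E] [NormedSpace ℝ E] [CompleteSpace E]
    (S : Set E) (hS1 : ∀ s ∈ S, ‖s‖ = 1)
    {E' : Type} [NormedAddCommGroup E'] [NormedSpace ℝ E'] [CompleteSpace E']
    (Φ : E' → E) (Φ' : E' →L[ℝ] E) (hΦ : HasStrictFDerivAt Φ Φ' 0) (hS : ∀ᶠ t in 𝓝 0, Φ t ∈ S)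
    (htop : ∀ x, ∃ (ρ : ℝ) (t : E'), x = ρ • Φ 0 + Φ' t) :
    ∀ᶠ x in 𝓝 (Φ 0), ‖x‖ = 1 → x ∈ S := by
  have h1 : HasStrictFDerivAt (fun x : ℝ × E' => Φ x.2)
      (Φ'.comp (ContinuousLinearMap.snd ℝ ℝ E')) ((1, 0) : ℝ × E') :=
    HasStrictFDerivAt.comp ((1, 0) : ℝ × E') (g := Φ) (f := Prod.snd) hΦ hasStrictFDerivAt_snd
  have h2 : HasStrictFDerivAt (fun x : ℝ × E' => x.1) (ContinuousLinearMap.fst ℝ ℝ E')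
      ((1, 0) : ℝ × E') := hasStrictFDerivAt_fst
  have h3 := h2.smul h1
  have h4 := h3.map_nhds_eq_of_surj (by
    rw [LinearMap.range_eq_top]
    intro x
    obtain ⟨ρ, t, h⟩ := htop x
    exact ⟨(ρ, t), by simp [h, add_comm]⟩)
  have hpos : ∀ᶠ x in 𝓝 ((1, 0) : ℝ × E'), 0 < x.1 :=
    (continuous_fst.tendsto ((1, 0) : ℝ × E')).eventually (lt_mem_nhds one_pos)
  have hS2 : ∀ᶠ x in 𝓝 ((1, 0) : ℝ × E'), Φ x.2 ∈ S :=
    (continuous_snd.tendsto ((1, 0) : ℝ × E')).eventually hS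
  have h5 : ((fun x : ℝ × E' => x.1 • Φ x.2) ((1, 0) : ℝ × E')) = Φ 0 := by simp
  have h6 := image_mem_map (m := fun x : ℝ × E' => x.1 • Φ x.2) (hpos.and hS2)
  change _ ∈ map ((Prod.fst : ℝ × E' → ℝ) • fun x : ℝ × E' => Φ x.2) _ at h6
  rw [show ((fun x : ℝ × E' => x.1) • fun x : ℝ × E' => Φ x.2)
    = (fun x : ℝ × E' => x.1 • Φ x.2) from rfl] at h4
  have h7 : (fun x : ℝ × E' => x.1 • Φ x.2) '' {x | 0 < x.1 ∧ Φ x.2 ∈ S} ∈ 𝓝 (Φ 0) := by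
    rw [← h5, ← h4]
    exact h6
  filter_upwards [h7]
  rintro _ ⟨⟨ρ, t⟩, ⟨hρ, ht⟩, rfl⟩ hn
  simp only [norm_smul, hS1 _ ht, mul_one, Real.norm_eq_abs] at hn hρ ht ⊢
  rw [abs_of_pos hρ] at hn
  rw [hn, one_smul]; exact ht

variable {E : Type*} [NormedAddCommGroup E] [InnerProductSpace ℂ E] [FiniteDimensional ℂ E]
  [CompleteSpace E]

/-- The span of the conjugates of the generators. -/
noncomputable def auxV (R F : Set (E →L[ℂ] E)) : Submodule ℝ (E →L[ℂ] E) :=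
  Submodule.span ℝ {Y | ∃ r ∈ R, ∃ X ∈ F, Y = star r * X * r}

lemma auxV_closed (V : Submodule ℝ (E →L[ℂ] E)) : IsClosed (V : Set (E →L[ℂ] E)) := by
  have h0 : FiniteDimensional ℂ (E →L[ℂ] E) := inferInstance
  have h1 : FiniteDimensional ℝ (E →L[ℂ] E) := FiniteDimensional.complexToReal _
  exact Submodule.closed_of_finiteDimensional V

lemma auxV_conjR (R F : Set (E →L[ℂ] E)) (hmul : ∀ a ∈ R, ∀ b ∈ R, a * b ∈ R)
    (r : E →L[ℂ] E) (hr : r ∈ R) (Y : E →L[ℂ] E) (hY : Y ∈ auxV R F) :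
    star r * Y * r ∈ auxV R F := by
  induction hY using Submodule.span_induction with
  | mem x hx =>
    obtain ⟨s, hs, X, hX, rfl⟩ := hx
    refine Submodule.subset_span ⟨s * r, hmul _ hs _ hr, X, hX, ?_⟩
    simp only [star_mul, mul_assoc]
  | zero => simp
  | add x y _ _ h1 h2 =>
    rw [mul_add, add_mul]; exact Submodule.add_mem _ h1 h2
  | smul a x _ h =>
    rw [mul_smul_comm, smul_mul_assoc]; exact Submodule.smul_mem _ _ h

lemma auxV_conjG (R F : Set (E →L[ℂ] E)) (hmul : ∀ a ∈ R, ∀ b ∈ R, a * b ∈ R)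
    (g : E →L[ℂ] E) (hg : g ∈ closure R) (Y : E →L[ℂ] E) (hY : Y ∈ auxV R F) :
    star g * Y * g ∈ auxV R F := by
  have hcl : IsClosed {g : E →L[ℂ] E | star g * Y * g ∈ (auxV R F : Set (E →L[ℂ] E))} :=
    (auxV_closed _).preimage (by fun_prop)
  exact closure_minimal (fun r hr => auxV_conjR R F hmul r hr Y hY) hcl hg

lemma auxV_br1 (R F : Set (E →L[ℂ] E)) (hmul : ∀ a ∈ R, ∀ b ∈ R, a * b ∈ R)
    (hexp : ∀ X ∈ F, ∀ t : ℝ, 0 ≤ t → NormedSpace.exp (t • X) ∈ R)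
    (hF : ∀ X ∈ F, star X = -X)
    (X : E →L[ℂ] E) (hX : X ∈ F) (Y : E →L[ℂ] E) (hY : Y ∈ auxV R F) :
    Y * X - X * Y ∈ auxV R F := by
  have h1 : HasDerivAt (fun t : ℝ => NormedSpace.exp (t • X)) (X) 0 := by
    have := hasDerivAt_exp_smul_const (𝕂 := ℝ) X 0
    simpa using this
  have h2 : HasDerivAt (fun t : ℝ => star (NormedSpace.exp (t • X))) (-X) 0 := by
    rw [← hF X hX]; exact h1.star
  have h3 := (h2.mul_const Y).mul h1
  have h4 := h3.tendsto_slope_zero_right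
  have h5 : -X * Y * NormedSpace.exp ((0 : ℝ) • X) + star (NormedSpace.exp ((0 : ℝ) • X)) * Y * X
      = Y * X - X * Y := by
    simp; abel
  rw [h5] at h4
  refine (auxV_closed (auxV R F)).mem_of_tendsto h4 ?_
  filter_upwards [self_mem_nhdsWithin] with t ht
  refine Submodule.smul_mem _ _ (Submodule.sub_mem _ ?_ ?_)
  · exact auxV_conjR R F hmul _ (hexp X hX _ (by simpa using (le_of_lt ht))) Y hY
  · exact auxV_conjR R F hmul _ (hexp X hX _ le_rfl) Y hY

lemma auxV_br (R F G : Set (E →L[ℂ] E)) (hmul : ∀ a ∈ R, ∀ b ∈ R, a * b ∈ R)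
    (hexp : ∀ X ∈ F, ∀ t : ℝ, 0 ≤ t → NormedSpace.exp (t • X) ∈ R)
    (hF : ∀ X ∈ F, star X = -X) (hRG : R ⊆ G) (hGR : G ⊆ closure R)
    (hGu : ∀ g ∈ G, star g * g = 1 ∧ g * star g = 1) (hGs : ∀ g ∈ G, star g ∈ G)
    (X : E →L[ℂ] E) (hX : X ∈ auxV R F) (Y : E →L[ℂ] E) (hY : Y ∈ auxV R F) :
    Y * X - X * Y ∈ auxV R F := by
  induction hX using Submodule.span_induction with
  | mem x hx =>
    obtain ⟨r, hr, X, hX, rfl⟩ := hx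
    have h1 : r * Y * star r ∈ auxV R F := by
      have := auxV_conjG R F hmul (star r) (hGR (hGs _ (hRG hr))) Y hY
      rwa [star_star] at this
    have h2 := auxV_conjR R F hmul r hr _ (auxV_br1 R F hmul hexp hF X hX _ h1)
    have h3 : star r * (r * Y * star r * X - X * (r * Y * star r)) * r
        = (star r * r) * Y * star r * X * r - star r * X * r * Y * (star r * r) := by
      simp only [mul_sub, sub_mul, mul_assoc]
    rw [h3, (hGu r (hRG hr)).1, one_mul, mul_one] at h2
    simpa only [mul_assoc] using h2
  | zero => simp
  | add x y _ _ h1 h2 =>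
    have : Y * (x + y) - (x + y) * Y = (Y * x - x * Y) + (Y * y - y * Y) := by
      rw [mul_add, add_mul]; abel
    rw [this]; exact Submodule.add_mem _ h1 h2
  | smul a x _ h =>
    rw [mul_smul_comm, smul_mul_assoc, ← smul_sub]; exact Submodule.smul_mem _ _ h

lemma auxV_skew (R F : Set (E →L[ℂ] E)) (hF : ∀ X ∈ F, star X = -X)
    (Y : E →L[ℂ] E) (hY : Y ∈ auxV R F) : star Y = - Y := by
  induction hY using Submodule.span_induction with
  | mem x hx =>
    obtain ⟨s, hs, X, hX, rfl⟩ := hx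
    simp [star_mul, hF X hX, mul_assoc]
  | zero => simp
  | add x y _ _ h1 h2 => rw [star_add, h1, h2]; abel
  | smul a x _ h => rw [star_smul, h]; simp

lemma aux_inner_star (X : E →L[ℂ] E) (x y : E) : inner ℂ (X x) y = inner ℂ x (star X y) := by
  rw [ContinuousLinearMap.star_eq_adjoint, ContinuousLinearMap.adjoint_inner_right]

theorem aux_main (R F G : Set (E →L[ℂ] E)) (hmul : ∀ a ∈ R, ∀ b ∈ R, a * b ∈ R)
    (hexp : ∀ X ∈ F, ∀ t : ℝ, 0 ≤ t → NormedSpace.exp (t • X) ∈ R)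
    (hF : ∀ X ∈ F, star X = -X) (hRG : R ⊆ G) (hGR : G ⊆ closure R)
    (hGu : ∀ g ∈ G, star g * g = 1 ∧ g * star g = 1) (hGs : ∀ g ∈ G, star g ∈ G)
    (hGt : ∀ z w : E, ‖z‖ = 1 → ‖w‖ = 1 → ∃ g ∈ G, g z = w)
    (hns : ∃ X ∈ F, ∀ c : ℂ, X ≠ c • (1 : E →L[ℂ] E))
    (z w : E) (hz : ‖z‖ = 1) (hw : ‖w‖ = 1) : ∃ r ∈ R, r z = w := by
  obtain ⟨X0, hX0F, hX0⟩ := hns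
  have h1R : (1 : E →L[ℂ] E) ∈ R := by simpa using hexp X0 hX0F 0 le_rfl
  have hcore := aux_core (auxV R F)
    (fun X hX x y => by
      rw [aux_inner_star, auxV_skew R F hF X hX]; simp)
    (fun X hX Y hY => auxV_br R F G hmul hexp hF hRG hGR hGu hGs Y hY X hX)
    ⟨X0, Submodule.subset_span ⟨1, h1R, X0, hX0F, by simp⟩, hX0⟩
    (fun z w hz hw => by
      obtain ⟨g, hg, hgz⟩ := hGt z w hz hw
      refine ⟨g, star g, (hGu g hg).2, (hGu g hg).1, fun x y => aux_inner_star g x y, hgz,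
        fun X hX => auxV_conjG R F hmul g (hGR hg) X hX, fun X hX => ?_⟩
      have := auxV_conjG R F hmul (star g) (hGR (hGs g hg)) X hX
      rwa [star_star] at this)
  have hiso : ∀ g ∈ G, ∀ x, ‖g x‖ = ‖x‖ := by
    intro g hg x
    have h1 : inner ℂ (g x) (g x) = inner ℂ x x := by
      rw [aux_inner_star, ← aux_mul_apply, (hGu g hg).1]; rfl
    rw [aux_norm_sq, aux_norm_sq] at h1
    have h2 : ‖g x‖ ^ 2 = ‖x‖ ^ 2 := by exact_mod_cast h1
    exact (pow_left_inj₀ (norm_nonneg _) (norm_nonneg _) two_ne_zero).1 h2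
  have hfd : FiniteDimensional ℝ E := FiniteDimensional.complexToReal E
  let S : Set E := {x | ∃ r ∈ R, r z = x}
  have hS1 : ∀ s ∈ S, ‖s‖ = 1 := by
    rintro _ ⟨r, hr, rfl⟩
    rw [hiso r (hRG hr), hz]
  let ι := {a : (E →L[ℂ] E) × (E →L[ℂ] E) // a.1 ∈ R ∧ a.2 ∈ F}
  let C : ι → ℝ → (E →L[ℝ] E) := fun i τ =>
    ((NormedSpace.exp ((1 + τ) • i.1.2) : E →L[ℂ] E) * i.1.1).restrictScalars ℝ
  let D : ι → (E →L[ℝ] E) := fun i => (star i.1.1 * i.1.2 * i.1.1).restrictScalars ℝ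
  obtain ⟨E', i1, i2, i3, Φ, Φ', hΦ, hΦS, hD⟩ := aux_krener S z ⟨1, h1R, rfl⟩ C D (by
      rintro ⟨⟨r, X⟩, hr, hX⟩
      have h0 : HasStrictDerivAt (fun τ : ℝ => NormedSpace.exp (τ • X))
          (NormedSpace.exp ((1 + 0 : ℝ) • X) * X) (1 + 0) := hasStrictDerivAt_exp_smul_const X _
      have h1 : HasStrictDerivAt (fun τ : ℝ => NormedSpace.exp ((1 + τ) • X))
          (NormedSpace.exp ((1 + 0 : ℝ) • X) * X) 0 := by
        have := h0.scomp (0 : ℝ) ((hasStrictDerivAt_id (0 : ℝ)).const_add 1)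
        simpa [Function.comp_def] using this
      have h2 := h1.mul_const r
      have h3 := (ContinuousLinearMap.restrictScalarsL ℂ E E ℝ ℝ).hasStrictFDerivAt.comp_hasStrictDerivAt
        (0 : ℝ) h2
      have h4 : (C ⟨(r, X), hr, hX⟩ 0 * D ⟨(r, X), hr, hX⟩) =
          (ContinuousLinearMap.restrictScalarsL ℂ E E ℝ ℝ)
            (NormedSpace.exp ((1 + 0 : ℝ) • X) * X * r) := by
        have : NormedSpace.exp ((1 + 0 : ℝ) • X) * X * r
          = (NormedSpace.exp ((1 + 0 : ℝ) • X) * r) * (star r * X * r) := by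
          have h5 : (NormedSpace.exp ((1 + 0 : ℝ) • X) * r) * (star r * X * r)
            = NormedSpace.exp ((1 + 0 : ℝ) • X) * (r * star r) * X * r := by
            simp only [mul_assoc]
          rw [h5, (hGu r (hRG hr)).2, mul_one]
        rw [this]; rfl
      rw [h4]; exact h3)
    (by
      rintro ⟨⟨r, X⟩, hr, hX⟩ x y hxy
      have hm : NormedSpace.exp ((1 + 0 : ℝ) • X) * r ∈ G :=
        hRG (hmul _ (hexp X hX _ (by norm_num)) _ hr)
      have h1 : (NormedSpace.exp ((1 + 0 : ℝ) • X) * r) x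
        = (NormedSpace.exp ((1 + 0 : ℝ) • X) * r) y := hxy
      have h2 := hiso _ hm (x - y)
      rw [map_sub, h1, sub_self, norm_zero] at h2
      exact sub_eq_zero.mp (norm_eq_zero.mp h2.symm))
    (by
      rintro ⟨⟨r, X⟩, hr, hX⟩
      filter_upwards [lt_mem_nhds (show (-1 : ℝ) < 0 by norm_num)] with τ hτ
      rintro _ ⟨s, hs, rfl⟩
      exact ⟨NormedSpace.exp ((1 + τ) • X) * r * s,
        hmul _ (hmul _ (hexp X hX _ (by linarith)) _ hr) _ hs, rfl⟩)
  have hp1 : ‖Φ 0‖ = 1 := hS1 _ hΦS.self_of_nhds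
  have hVp : ∀ X ∈ auxV R F, X (Φ 0) ∈ LinearMap.range (Φ' : E' →ₗ[ℝ] E) := by
    intro X hX
    induction hX using Submodule.span_induction with
    | mem x hx =>
      obtain ⟨r, hr, X, hX, rfl⟩ := hx
      exact hD ⟨(r, X), hr, hX⟩
    | zero => simp
    | add x y _ _ h1 h2 => exact Submodule.add_mem _ h1 h2
    | smul a x _ h => exact Submodule.smul_mem _ a h
  have htop : ∀ x, x ∈ LinearMap.range (Φ' : E' →ₗ[ℝ] E) ⊔ Submodule.span ℝ {Φ 0} := by
    intro x
    apply aux_sep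
    intro v hv
    have : v = 0 := by
      refine hcore (Φ 0) v hp1 (fun X hX => hv _ (Submodule.mem_sup_left (hVp X hX))) ?_
      have := hv _ (Submodule.mem_sup_right (Submodule.mem_span_singleton_self _))
      rw [← inner_conj_symm, Complex.conj_re]; exact this
    rw [this]; simp
  have hopen := aux_open S hS1 Φ Φ' hΦ hΦS (by
    intro x
    obtain ⟨_, ⟨t, rfl⟩, q, hq, h⟩ := Submodule.mem_sup.1 (htop x)
    obtain ⟨ρ, rfl⟩ := Submodule.mem_span_singleton.1 hq
    exact ⟨ρ, t, by rw [← h, add_comm]; rfl⟩)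
  obtain ⟨g, hg, hgw⟩ := hGt w (Φ 0) hw hp1
  have hcl := hGR (hGs g hg)
  have hcont : Tendsto (fun a : E →L[ℂ] E => (star a) w) (𝓝 (star g)) (𝓝 (Φ 0)) := by
    have : Continuous (fun a : E →L[ℂ] E => (star a) w) := by fun_prop
    have h := this.tendsto (star g)
    rwa [star_star, hgw] at h
  obtain ⟨r, hrw, hr⟩ := ((mem_closure_iff_frequently.1 hcl).and_eventually
    (hcont.eventually hopen)).exists.imp fun a h => And.intro h.2 h.1
  obtain ⟨s, hs, hsz⟩ := hrw (by rw [hiso _ (hGs r (hRG hr)), hw])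
  refine ⟨r * s, hmul _ hr _ hs, ?_⟩
  rw [aux_mul_apply, hsz, ← aux_mul_apply, (hGu r (hRG hr)).2]; rfl

theorem aux_main' (R F G : Set (E →L[ℂ] E)) (hmul : ∀ a ∈ R, ∀ b ∈ R, a * b ∈ R)
    (hexp : ∀ X ∈ F, ∀ t : ℝ, 0 ≤ t → NormedSpace.exp ((t : ℂ) • X) ∈ R)
    (hF : ∀ X ∈ F, star X = -X) (hRG : R ⊆ G) (hGR : G ⊆ closure R)
    (hGu : ∀ g ∈ G, star g * g = 1 ∧ g * star g = 1) (hGs : ∀ g ∈ G, star g ∈ G)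
    (hGt : ∀ z w : E, ‖z‖ = 1 → ‖w‖ = 1 → ∃ g ∈ G, g z = w)
    (hns : ∃ X ∈ F, ∀ c : ℂ, X ≠ c • (1 : E →L[ℂ] E))
    (z w : E) (hz : ‖z‖ = 1) (hw : ‖w‖ = 1) : ∃ r ∈ R, r z = w :=
  aux_main R F G hmul (fun X hX t ht => by
    rw [← Complex.coe_smul]; exact hexp X hX t ht) hF hRG hGR hGu hGs hGt hns z w hz hw

end PartB

section PartC

open MeasureTheory Set intervalIntegral

lemma aux_clm_ii {W W' : Type*} [NormedAddCommGroup W] [NormedSpace ℝ W]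
    [NormedAddCommGroup W'] [NormedSpace ℝ W'] (L : W →L[ℝ] W') (f : ℝ → W) (a b : ℝ)
    (hf : IntervalIntegrable f volume a b) : IntervalIntegrable (fun s => L (f s)) volume a b :=
  ⟨L.integrable_comp hf.1, L.integrable_comp hf.2⟩

lemma aux_concat {W : Type*} [NormedAddCommGroup W] [NormedSpace ℝ W] [CompleteSpace W]
    (L : W →L[ℝ] W) (T₁ T₂ : ℝ) (h₁ : 0 ≤ T₁) (h₂ : 0 ≤ T₂) (f₁ f₂ g₁ g₂ F g : ℝ → W)
    (hf₁ : IntervalIntegrable f₁ volume 0 T₁) (hf₂ : IntervalIntegrable f₂ volume 0 T₂)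
    (hg₁ : ∀ t ∈ Icc 0 T₁, g₁ t = g₁ 0 + ∫ s in (0 : ℝ)..t, f₁ s)
    (hg₂ : ∀ t ∈ Icc 0 T₂, g₂ t = g₂ 0 + ∫ s in (0 : ℝ)..t, f₂ s)
    (hL : L (g₂ 0) = g₁ T₁)
    (hF₁ : ∀ t, t ≤ T₁ → F t = f₁ t) (hF₂ : ∀ t, T₁ < t → F t = L (f₂ (t - T₁)))
    (hG₁ : ∀ t, t ≤ T₁ → g t = g₁ t) (hG₂ : ∀ t, T₁ < t → g t = L (g₂ (t - T₁))) :
    IntervalIntegrable F volume 0 (T₁ + T₂) ∧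
    ∀ t ∈ Icc 0 (T₁ + T₂), g t = g 0 + ∫ s in (0 : ℝ)..t, F s := by
  have i1 : IntervalIntegrable F volume 0 T₁ := by
    refine (intervalIntegrable_congr fun t ht => ?_).2 hf₁
    rw [uIoc_of_le h₁] at ht
    exact hF₁ t ht.2
  have i2' : IntervalIntegrable (fun s => L (f₂ (s - T₁))) volume T₁ (T₁ + T₂) := by
    have := (aux_clm_ii L f₂ 0 T₂ hf₂).comp_sub_right T₁
    rwa [zero_add, add_comm] at this
  have i2 : IntervalIntegrable F volume T₁ (T₁ + T₂) := by
    refine (intervalIntegrable_congr fun t ht => ?_).2 i2'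
    rw [uIoc_of_le (by linarith)] at ht
    exact hF₂ t ht.1
  refine ⟨i1.trans i2, fun t ht => ?_⟩
  have hfirst : ∀ t ∈ Icc 0 T₁, ∫ s in (0 : ℝ)..t, F s = ∫ s in (0 : ℝ)..t, f₁ s := by
    intro t ht
    refine integral_congr fun s hs => ?_
    rw [uIcc_of_le ht.1] at hs
    exact hF₁ s (hs.2.trans ht.2)
  rw [hG₁ 0 h₁]
  rcases le_or_gt t T₁ with h | h
  · rw [hG₁ t h, hfirst t ⟨ht.1, h⟩]
    exact hg₁ t ⟨ht.1, h⟩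
  · have j2 : IntervalIntegrable F volume T₁ t := i2.mono_set (by
      rw [uIcc_of_le h.le, uIcc_of_le (by linarith)]
      exact Icc_subset_Icc le_rfl ht.2)
    rw [← integral_add_adjacent_intervals i1 j2, hfirst T₁ ⟨h₁, le_rfl⟩, ← add_assoc,
      ← hg₁ T₁ ⟨h₁, le_rfl⟩, hG₂ t h, hg₂ (t - T₁) ⟨by linarith, by linarith [ht.2]⟩, map_add, hL]
    congr 1
    rw [← L.intervalIntegral_comp_comm (hf₂.mono_set (by
      rw [uIcc_of_le (by linarith), uIcc_of_le h₂]
      exact Icc_subset_Icc le_rfl (by linarith [ht.2])))]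
    have : ∫ s in T₁..t, F s = ∫ s in T₁..t, L (f₂ (s - T₁)) := by
      refine integral_congr_ae (Filter.Eventually.of_forall fun s hs => ?_)
      rw [uIoc_of_le h.le] at hs
      exact hF₂ s hs.1
    rw [this, integral_comp_sub_right (fun s => L (f₂ s)), sub_self]

lemma aux_control_concat {m : ℕ} (U : Set (EuclideanSpace ℝ (Fin m))) (T₁ T₂ : ℝ)
    (h₁ : 0 ≤ T₁) (h₂ : 0 ≤ T₂) (u₁ u₂ : ℝ → EuclideanSpace ℝ (Fin m))
    (hu₁ : IsAdmissibleControl U T₁ u₁) (hu₂ : IsAdmissibleControl U T₂ u₂) :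
    IsAdmissibleControl U (T₁ + T₂) (fun t => if t ≤ T₁ then u₁ t else u₂ (t - T₁)) := by
  obtain ⟨m₁, v₁, C₁, b₁⟩ := hu₁
  obtain ⟨m₂, v₂, C₂, b₂⟩ := hu₂
  have hcase : ∀ t ∈ Icc 0 (T₁ + T₂), ¬ t ≤ T₁ → t - T₁ ∈ Icc 0 T₂ := fun t ht h =>
    ⟨by linarith, by linarith [ht.2]⟩
  refine ⟨?_, ?_, max C₁ C₂, ?_⟩
  · have hU : Icc 0 (T₁ + T₂) = Icc 0 T₁ ∪ Ioc T₁ (T₁ + T₂) :=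
      (Icc_union_Ioc_eq_Icc h₁ (by linarith)).symm
    rw [hU, aestronglyMeasurable_union_iff]
    constructor
    · refine m₁.congr ?_
      filter_upwards [ae_restrict_mem measurableSet_Icc] with t ht
      rw [if_pos ht.2]
    · have hmp : MeasurePreserving (fun t : ℝ => t - T₁)
          (volume.restrict ((fun t : ℝ => t - T₁) ⁻¹' Icc 0 T₂)) (volume.restrict (Icc 0 T₂)) :=
        (measurePreserving_sub_right volume T₁).restrict_preimage measurableSet_Icc
      have h3 := m₂.comp_measurePreserving hmp
      have h4 : AEStronglyMeasurable (u₂ ∘ fun t : ℝ => t - T₁)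
          (volume.restrict (Ioc T₁ (T₁ + T₂))) := by
        refine h3.mono_measure (Measure.restrict_mono ?_ le_rfl)
        intro t ht
        exact ⟨by linarith [ht.1], by linarith [ht.2]⟩
      refine h4.congr ?_
      filter_upwards [ae_restrict_mem measurableSet_Ioc] with t ht
      rw [if_neg (not_le.2 ht.1)]; rfl
  · intro t ht
    by_cases h : t ≤ T₁
    · simp only [if_pos h]; exact v₁ t ⟨ht.1, h⟩
    · simp only [if_neg h]; exact v₂ _ (hcase t ht h)
  · intro t ht
    by_cases h : t ≤ T₁
    · simp only [if_pos h]; exact (b₁ t ⟨ht.1, h⟩).trans (le_max_left _ _)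
    · simp only [if_neg h]; exact (b₂ _ (hcase t ht h)).trans (le_max_right _ _)

/-- A Gronwall type uniqueness lemma with integrable coefficient. -/
lemma aux_gronwall (T : ℝ) (y f : ℝ → ℂ) (k : ℝ → ℝ)
    (hk : IntervalIntegrable k volume 0 T) (hk0 : ∀ s, 0 ≤ k s)
    (hf : IntervalIntegrable f volume 0 T)
    (hfk : ∀ s ∈ Icc 0 T, ‖f s‖ ≤ k s * ‖y s‖)
    (hy : ∀ t ∈ Icc 0 T, y t = ∫ s in (0 : ℝ)..t, f s) : ∀ t ∈ Icc 0 T, y t = 0 := by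
  rcases lt_or_ge T 0 with hT | hT
  · intro t ht; linarith [ht.1, ht.2]
  have hsub : ∀ a ∈ Icc 0 T, ∀ b ∈ Icc 0 T, uIcc a b ⊆ uIcc 0 T := fun a ha b hb => by
    rw [uIcc_of_le hT]; exact uIcc_subset_Icc ha hb
  have h0T : (0 : ℝ) ∈ Icc 0 T := ⟨le_rfl, hT⟩
  have hyc : ContinuousOn y (Icc 0 T) := by
    have h1 := continuousOn_primitive_interval' hf (a := 0) (by rw [uIcc_of_le hT]; exact h0T)
    rw [uIcc_of_le hT] at h1
    exact h1.congr hy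
  have hac : ContinuousOn (fun t => ∫ s in (0 : ℝ)..t, k s) (Icc 0 T) := by
    have h1 := continuousOn_primitive_interval' hk (a := 0) (by rw [uIcc_of_le hT]; exact h0T)
    rwa [uIcc_of_le hT] at h1
  have huc := isCompact_Icc.uniformContinuousOn_of_continuous hac
  rw [Metric.uniformContinuousOn_iff] at huc
  obtain ⟨δ, hδ, huc⟩ := huc (1 / 2) (by norm_num)
  -- one step
  have hstep : ∀ a ∈ Icc 0 T, y a = 0 → ∀ t ∈ Icc 0 T, a ≤ t → t < a + δ → y t = 0 := by
    intro a ha hya t ht hat htδ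
    have hcpt : IsCompact (Icc a t) := isCompact_Icc
    have hIsub : Icc a t ⊆ Icc 0 T := Icc_subset_Icc ha.1 ht.2
    obtain ⟨c, hc, hmax⟩ := hcpt.exists_isMaxOn ⟨a, left_mem_Icc.2 hat⟩
      ((hyc.mono hIsub).norm)
    have hcT := hIsub hc
    have hkc : IntervalIntegrable k volume a c := hk.mono_set (hsub a ha c hcT)
    have e1 : y c = ∫ s in a..c, f s := by
      have := integral_add_adjacent_intervals (hf.mono_set (hsub 0 h0T a ha))
        (hf.mono_set (hsub a ha c hcT))
      rw [hy c hcT, ← this, ← hy a ha, hya, zero_add]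
    have e2 : ∫ s in a..c, k s < 1 / 2 := by
      have h1 := huc c hcT a ha (by rw [Real.dist_eq, abs_lt]; constructor <;> linarith [hc.1, hc.2])
      have h2 := integral_add_adjacent_intervals (hk.mono_set (hsub 0 h0T a ha)) hkc
      rw [Real.dist_eq, ← h2, add_sub_cancel_left] at h1
      exact (abs_lt.1 h1).2
    have e3 : ‖y c‖ ≤ (∫ s in a..c, k s) * ‖y c‖ := by
      rw [← intervalIntegral.integral_mul_const]
      conv_lhs => rw [e1]
      refine norm_integral_le_of_norm_le hc.1 (Filter.Eventually.of_forall fun s hs => ?_)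
        (hkc.mul_const _)
      have hs' : s ∈ Icc a t := ⟨hs.1.le, hs.2.trans hc.2⟩
      exact (hfk s (hIsub hs')).trans (mul_le_mul_of_nonneg_left (hmax hs') (hk0 s))
    have e4 : ‖y c‖ = 0 := by nlinarith [norm_nonneg (y c)]
    have e5 : ‖y t‖ ≤ ‖y c‖ := hmax (right_mem_Icc.2 hat)
    exact norm_eq_zero.1 (le_antisymm (e5.trans e4.le) (norm_nonneg _))
  have hind : ∀ N : ℕ, ∀ t ∈ Icc 0 T, t ≤ N * (δ / 2) → y t = 0 := by
    intro N
    induction N with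
    | zero =>
      intro t ht h
      have : t = 0 := le_antisymm (by simpa using h) ht.1
      rw [hy t ht, this, integral_same]
    | succ N ih =>
      intro t ht h
      push_cast at h
      rcases le_or_gt t (N * (δ / 2)) with h1 | h1
      · exact ih t ht h1
      · have hN : (0 : ℝ) ≤ N * (δ / 2) := by positivity
        exact hstep (N * (δ / 2)) ⟨hN, h1.le.trans ht.2⟩ (ih _ ⟨hN, h1.le.trans ht.2⟩ le_rfl) t ht
          h1.le (by linarith)
  intro t ht
  obtain ⟨N, hN⟩ := exists_nat_ge (t / (δ / 2))
  exact hind N t ht (by rwa [div_le_iff₀ (by positivity)] at hN)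



/-- Right multiplication as a continuous real linear map. -/
noncomputable def auxRight {n : ℕ} (B : Matrix (Fin n) (Fin n) ℂ) :
    Matrix (Fin n) (Fin n) ℂ →L[ℝ] Matrix (Fin n) (Fin n) ℂ :=
  LinearMap.toContinuousLinearMap
    { toFun := fun A => A * B
      map_add' := fun _ _ => add_mul _ _ _
      map_smul' := fun c A => by simp }

lemma auxRight_apply {n : ℕ} (A B : Matrix (Fin n) (Fin n) ℂ) : auxRight B A = A * B := rfl

/-- Evaluation of a matrix at a vector as a continuous real linear map. -/
noncomputable def auxEv {n : ℕ} (x : EuclideanSpace ℂ (Fin n)) :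
    Matrix (Fin n) (Fin n) ℂ →L[ℝ] EuclideanSpace ℂ (Fin n) :=
  LinearMap.toContinuousLinearMap
    { toFun := fun A => Matrix.toEuclideanLin A x
      map_add' := fun _ _ => by simp
      map_smul' := fun c A => by
        rw [← Complex.coe_smul, map_smul]; rfl }

lemma auxEv_apply {n : ℕ} (A : Matrix (Fin n) (Fin n) ℂ) (x : EuclideanSpace ℂ (Fin n)) :
    auxEv x A = Matrix.toEuclideanLin A x := rfl

lemma aux_lifted_mul {n m : ℕ} (U : Set (EuclideanSpace ℝ (Fin m)))
    (Hmat : EuclideanSpace ℝ (Fin m) → Matrix (Fin n) (Fin n) ℂ)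
    (a b : Matrix (Fin n) (Fin n) ℂ) (ha : a ∈ liftedReachable U Hmat 1)
    (hb : b ∈ liftedReachable U Hmat 1) : a * b ∈ liftedReachable U Hmat 1 := by
  obtain ⟨T₂, h₂, u₂, g₂, hu₂, ⟨un₂, ii₂, eq₂⟩, g20, g2T⟩ := ha
  obtain ⟨T₁, h₁, u₁, g₁, hu₁, ⟨un₁, ii₁, eq₁⟩, g10, g1T⟩ := hb
  have hc := aux_concat (auxRight b) T₁ T₂ h₁ h₂
    (fun s => (-Complex.I) • (Hmat (u₁ s) * g₁ s))
    (fun s => (-Complex.I) • (Hmat (u₂ s) * g₂ s)) g₁ g₂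
    (fun s => (-Complex.I) • (Hmat (if s ≤ T₁ then u₁ s else u₂ (s - T₁)) *
      (if s ≤ T₁ then g₁ s else g₂ (s - T₁) * b)))
    (fun s => if s ≤ T₁ then g₁ s else g₂ (s - T₁) * b)
    ii₁ ii₂ eq₁ eq₂ (by change g₂ 0 * b = g₁ T₁; rw [g20, one_mul, g1T])
    (fun t ht => by simp only [if_pos ht])
    (fun t ht => by
      simp only [if_neg (not_le.2 ht)]
      change _ = (-Complex.I) • (Hmat (u₂ (t - T₁)) * g₂ (t - T₁)) * b
      simp only [smul_mul_assoc, mul_assoc])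
    (fun t ht => by simp only [if_pos ht])
    (fun t ht => by simp only [if_neg (not_le.2 ht)]; rfl)
  refine ⟨T₁ + T₂, by linarith, fun t => if t ≤ T₁ then u₁ t else u₂ (t - T₁),
    fun s => if s ≤ T₁ then g₁ s else g₂ (s - T₁) * b,
    aux_control_concat U T₁ T₂ h₁ h₂ u₁ u₂ hu₁ hu₂, ⟨?_, hc.1, hc.2⟩, ?_, ?_⟩
  · intro t ht
    by_cases h : t ≤ T₁
    · simp only [if_pos h]; exact un₁ t ⟨ht.1, h⟩
    · simp only [if_neg h]
      refine mul_mem (un₂ _ ⟨by linarith, by linarith [ht.2]⟩) ?_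
      rw [← g1T]; exact un₁ T₁ ⟨h₁, le_rfl⟩
  · simp only [if_pos h₁, g10]
  · by_cases h : T₁ + T₂ ≤ T₁
    · have h0 : T₂ = 0 := by linarith
      subst h0
      simp only [add_zero, le_refl, if_true]
      rw [g1T, ← g2T, g20, one_mul]
    · simp only [if_neg h, add_sub_cancel_left, g2T]

lemma aux_exp_unitary {E : Type*} [NormedAddCommGroup E] [InnerProductSpace ℂ E]
    [FiniteDimensional ℂ E] [CompleteSpace E] (X : E →L[ℂ] E) (hX : star X = -X) (t : ℝ) :
    NormedSpace.exp ((t : ℂ) • X) ∈ unitary (E →L[ℂ] E) := by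
  letI : NormedAlgebra ℚ (E →L[ℂ] E) := NormedAlgebra.restrictScalars ℚ ℂ (E →L[ℂ] E)
  refine NormedSpace.exp_mem_unitary_of_mem_skewAdjoint ?_
  rw [skewAdjoint.mem_iff, star_smul, hX]; simp

lemma aux_exp_zero {E : Type*} [NormedAddCommGroup E] [InnerProductSpace ℂ E]
    [FiniteDimensional ℂ E] [CompleteSpace E] (X : E →L[ℂ] E) :
    NormedSpace.exp (((0 : ℝ) : ℂ) • X) = 1 := by
  rw [Complex.ofReal_zero, zero_smul, NormedSpace.exp_zero]

lemma aux_exp_deriv {E : Type*} [NormedAddCommGroup E] [InnerProductSpace ℂ E]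
    [FiniteDimensional ℂ E] [CompleteSpace E] (X : E →L[ℂ] E) (z : ℂ) :
    HasDerivAt (fun z : ℂ => NormedSpace.exp (z • X)) (X * NormedSpace.exp (z • X)) z :=
  hasDerivAt_exp_smul_const' X z

lemma aux_map_unitary {n : ℕ} (g : Matrix (Fin n) (Fin n) ℂ) :
    g ∈ Matrix.unitaryGroup (Fin n) ℂ ↔ Matrix.toEuclideanCLM (n := Fin n) (𝕜 := ℂ) g ∈
      unitary (EuclideanSpace ℂ (Fin n) →L[ℂ] EuclideanSpace ℂ (Fin n)) := by
  have h : ∀ a : Matrix (Fin n) (Fin n) ℂ,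
      Matrix.toEuclideanCLM (n := Fin n) (𝕜 := ℂ) a = 1 ↔ a = 1 := fun a =>
    map_eq_one_iff _ (Matrix.toEuclideanCLM (n := Fin n) (𝕜 := ℂ)).injective
  rw [Matrix.unitaryGroup, Unitary.mem_iff, Unitary.mem_iff, ← map_star, ← map_mul, ← map_mul,
    h, h]

lemma aux_lifted_exp {n m : ℕ} (U : Set (EuclideanSpace ℝ (Fin m)))
    (Hmat : EuclideanSpace ℝ (Fin m) → Matrix (Fin n) (Fin n) ℂ)
    (v : EuclideanSpace ℝ (Fin m)) (hv : v ∈ U) (hH : (Hmat v).IsHermitian) (T : ℝ) (hT : 0 ≤ T) :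
    ∃ g ∈ liftedReachable U Hmat 1, Matrix.toEuclideanCLM (n := Fin n) (𝕜 := ℂ) g
      = NormedSpace.exp ((T : ℂ) • (Matrix.toEuclideanCLM (n := Fin n) (𝕜 := ℂ)
        ((-Complex.I) • Hmat v))) := by
  set Λ := Matrix.toEuclideanCLM (n := Fin n) (𝕜 := ℂ) with hΛ
  set X := Λ ((-Complex.I) • Hmat v) with hX
  let M : (EuclideanSpace ℂ (Fin n) →L[ℂ] EuclideanSpace ℂ (Fin n)) →L[ℂ]
      Matrix (Fin n) (Fin n) ℂ :=
    LinearMap.toContinuousLinearMap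
      (Λ.symm.toAlgEquiv.toLinearMap : _ →ₗ[ℂ] Matrix (Fin n) (Fin n) ℂ)
  have hM : ∀ a, M a = Λ.symm a := fun a => rfl
  have hMX : ∀ a, M (X * a) = (-Complex.I) • (Hmat v * M a) := by
    intro a
    rw [hM, map_mul, hX, StarAlgEquiv.symm_apply_apply, smul_mul_assoc, hM]
  have hskew : star X = - X := by
    rw [hX, ← map_star, ← map_neg]
    congr 1
    rw [star_smul, Matrix.star_eq_conjTranspose, hH.eq]
    simp
  let g : ℝ → Matrix (Fin n) (Fin n) ℂ := fun t => M (NormedSpace.exp ((t : ℂ) • X))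
  have hd : ∀ t, HasDerivAt g ((-Complex.I) • (Hmat v * g t)) t := by
    intro t
    have h1 := aux_exp_deriv X (t : ℂ)
    have h2 : HasDerivAt (fun z : ℂ => M (NormedSpace.exp (z • X)))
        (M (X * NormedSpace.exp ((t : ℂ) • X))) (t : ℂ) :=
      M.hasFDerivAt.comp_hasDerivAt (t : ℂ) h1
    have h3 := h2.scomp t (Complex.ofRealCLM.hasDerivAt (x := t))
    rw [Complex.ofRealCLM_apply, Complex.ofReal_one, one_smul] at h3
    have h4 : M (X * NormedSpace.exp ((t : ℂ) • X)) = (-Complex.I) • (Hmat v * g t) := hMX _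
    rw [h4] at h3
    exact h3
  have hgc : Continuous g := continuous_iff_continuousAt.2 fun t => (hd t).continuousAt
  have hcont : Continuous fun s => (-Complex.I) • (Hmat v * g s) := by fun_prop
  refine ⟨g T, ⟨T, hT, fun _ => v, g, ⟨aestronglyMeasurable_const, fun _ _ => hv, ‖v‖,
    fun _ _ => le_rfl⟩, ⟨?_, hcont.intervalIntegrable _ _, ?_⟩, ?_, rfl⟩, ?_⟩
  · intro t _
    rw [aux_map_unitary]
    have h2 := aux_exp_unitary X hskew t
    change Λ (Λ.symm _) ∈ _
    rw [StarAlgEquiv.apply_symm_apply]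
    exact h2
  · intro t _
    rw [integral_eq_sub_of_hasDerivAt (fun s _ => hd s) (hcont.intervalIntegrable _ _)]
    abel
  · change Λ.symm (NormedSpace.exp (((0 : ℝ) : ℂ) • X)) = 1
    exact (congrArg Λ.symm (aux_exp_zero X)).trans (map_one _)
  · change Λ (Λ.symm _) = _
    rw [StarAlgEquiv.apply_symm_apply]

lemma aux_unit_norm {n : ℕ} (g : Matrix (Fin n) (Fin n) ℂ)
    (hg : g ∈ Matrix.unitaryGroup (Fin n) ℂ) (x : EuclideanSpace ℂ (Fin n)) :
    ‖Matrix.toEuclideanLin g x‖ = ‖x‖ := by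
  have h := (aux_map_unitary g).1 hg
  exact ContinuousLinearMap.norm_map_of_mem_unitary h x

lemma aux_lift_sphere {n m : ℕ} 
    (Hmat : EuclideanSpace ℝ (Fin m) → Matrix (Fin n) (Fin n) ℂ) (T : ℝ)
    (u : ℝ → EuclideanSpace ℝ (Fin m)) (g : ℝ → Matrix (Fin n) (Fin n) ℂ)
    (hT : 0 ≤ T)
    (h : IsLiftedTrajectory Hmat T u g) (x : EuclideanSpace ℂ (Fin n)) (hx : ‖x‖ = 1) :
    IsSphereTrajectory Hmat T u (fun t => Matrix.toEuclideanLin (g t) x) := by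
  obtain ⟨un, ii, eq⟩ := h
  have hfun : (fun s => (-Complex.I) • Matrix.toEuclideanLin (Hmat (u s))
      (Matrix.toEuclideanLin (g s) x)) =
      fun s => auxEv x ((-Complex.I) • (Hmat (u s) * g s)) := by
    funext s
    rw [auxEv_apply, map_smul]
    congr 1
    have := map_mul (Matrix.toEuclideanCLM (n := Fin n) (𝕜 := ℂ)) (Hmat (u s)) (g s)
    exact (congrArg (fun f : EuclideanSpace ℂ (Fin n) →L[ℂ] EuclideanSpace ℂ (Fin n) => f x)
      this).symm
  refine ⟨fun t ht => ?_, ?_, fun t ht => ?_⟩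
  · rw [mem_sphere_zero_iff_norm, aux_unit_norm _ (un t ht), hx]
  · rw [hfun]; exact aux_clm_ii _ _ _ _ ii
  · have h1 :=
      IntervalIntegrable.mono_set (b := T) (a := 0) (c := 0) (d := t) ii (by
        rw [uIcc_of_le ht.1, uIcc_of_le hT]; exact Icc_subset_Icc le_rfl ht.2)
    have h2 := congrArg (auxEv x) (eq t ht)
    rw [map_add] at h2
    have h3 := (auxEv x).intervalIntegral_comp_comm h1
    have h4 := congrArg (fun f : ℝ → EuclideanSpace ℂ (Fin n) => ∫ s in (0 : ℝ)..t, f s) hfun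
    exact h2.trans (congrArg (fun w => auxEv x (g 0) + w) (h4.trans h3).symm)

/-- If all Hamiltonians are scalar, orthogonality is preserved. -/
lemma aux_scalar {n m : ℕ} (U : Set (EuclideanSpace ℝ (Fin m)))
    (Hmat : EuclideanSpace ℝ (Fin m) → Matrix (Fin n) (Fin n) ℂ)
    (hs : ∀ v ∈ U, ∃ c : ℂ, (-Complex.I) • Hmat v = c • (1 : Matrix (Fin n) (Fin n) ℂ))
    (T : ℝ) (hT : 0 ≤ T) (u : ℝ → EuclideanSpace ℝ (Fin m)) (hu : ∀ t ∈ Icc 0 T, u t ∈ U)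
    (ψ : ℝ → EuclideanSpace ℂ (Fin n)) (hψ : IsSphereTrajectory Hmat T u ψ)
    (φ : EuclideanSpace ℂ (Fin n)) (h0 : inner ℂ φ (ψ 0) = 0) : inner ℂ φ (ψ T) = 0 := by
  obtain ⟨un, ii, eq⟩ := hψ
  set F := fun s => (-Complex.I) • Matrix.toEuclideanLin (Hmat (u s)) (ψ s) with hF
  have hFc : ∀ s ∈ Icc 0 T, ∃ c : ℂ, F s = c • ψ s := by
    intro s hs'
    obtain ⟨c, hc⟩ := hs (u s) (hu s hs')
    refine ⟨c, ?_⟩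
    have : F s = Matrix.toEuclideanLin ((-Complex.I) • Hmat (u s)) (ψ s) := by
      rw [map_smul]; rfl
    rw [this, hc, map_smul]
    simp
  let L : EuclideanSpace ℂ (Fin n) →L[ℝ] ℂ := (innerSL ℂ φ).restrictScalars ℝ
  refine aux_gronwall T (fun t => inner ℂ φ (ψ t)) (fun s => L (F s)) (fun s => ‖F s‖) ii.norm
    (fun _ => norm_nonneg _) (aux_clm_ii L F _ _ ii) ?_ ?_ T ⟨hT, le_rfl⟩
  · intro s hs'
    obtain ⟨c, hc⟩ := hFc s hs'
    have h1 : L (F s) = c * inner ℂ φ (ψ s) := by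
      rw [hc]; exact inner_smul_right (𝕜 := ℂ) φ (ψ s) c
    have h2 : ‖ψ s‖ = 1 := by simpa using un s hs'
    simp only [h1, norm_mul]
    rw [hc, norm_smul, h2, mul_one]
  · intro t ht
    have h1 : IntervalIntegrable F volume 0 t :=
      ii.mono_set (by rw [uIcc_of_le ht.1, uIcc_of_le hT]; exact Icc_subset_Icc le_rfl ht.2)
    have h2 := congrArg L (eq t ht)
    rw [map_add, ← L.intervalIntegral_comp_comm h1] at h2
    have h3 : L (ψ 0) = 0 := h0
    rw [h3, zero_add] at h2
    exact h2

end PartC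

/-- final Remark of the paper. Let `𝒢` be a subgroup of `U(n)`
acting transitively on the unit sphere of `ℂ^n`.  If the reachable set from the
identity of the lifted system `i·ġ = H(u)·g` is dense in `𝒢`, then the system
`i·ψ̇ = H(u)·ψ` is exactly controllable on the unit sphere. -/
theorem dense_in_transitive_subgroup_implies_exact_controllability {n m : ℕ}
    (hn : 2 ≤ n)
    (U : Set (EuclideanSpace ℝ (Fin m)))
    (Hmat : EuclideanSpace ℝ (Fin m) → Matrix (Fin n) (Fin n) ℂ)
    (hherm : ∀ u ∈ U, (Hmat u).IsHermitian)
    (hsmooth : ContDiffOn ℝ (⊤ : ℕ∞) Hmat U)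
    (G : Set (Matrix (Fin n) (Fin n) ℂ))
    (hGU : G ⊆ (Matrix.unitaryGroup (Fin n) ℂ : Set (Matrix (Fin n) (Fin n) ℂ)))
    (hGone : (1 : Matrix (Fin n) (Fin n) ℂ) ∈ G)
    (hGmul : ∀ a ∈ G, ∀ b ∈ G, a * b ∈ G)
    (hGinv : ∀ a ∈ G, star a ∈ G)
    (hGtrans : ∀ z ∈ Metric.sphere (0 : EuclideanSpace ℂ (Fin n)) 1,
      ∀ w ∈ Metric.sphere (0 : EuclideanSpace ℂ (Fin n)) 1,
      ∃ g ∈ G, Matrix.toEuclideanLin g z = w)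
    (hsub : liftedReachable U Hmat 1 ⊆ G)
    (hdense : G ⊆ closure (liftedReachable U Hmat 1)) :
    ∀ ψ0 ∈ Metric.sphere (0 : EuclideanSpace ℂ (Fin n)) 1,
      sphereReachable U Hmat ψ0 = Metric.sphere (0 : EuclideanSpace ℂ (Fin n)) 1 := by
  intro ψ0 hψ0
  have hψ0' : ‖ψ0‖ = 1 := mem_sphere_zero_iff_norm.1 hψ0
  apply Set.Subset.antisymm
  · rintro ψ1 ⟨T, hT, u, ψ, _, hψ, _, rfl⟩
    exact hψ.1 T ⟨hT, le_rfl⟩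
  intro ψ1 hψ1
  have hψ1' : ‖ψ1‖ = 1 := mem_sphere_zero_iff_norm.1 hψ1
  set R := liftedReachable U Hmat 1 with hR
  -- the action of reachable elements
  have hact : ∀ r ∈ R, ∀ x : EuclideanSpace ℂ (Fin n), ‖x‖ = 1 →
      Matrix.toEuclideanLin r x ∈ sphereReachable U Hmat x := by
    rintro r ⟨T, hT, u, g, hu, hg, hg0, rfl⟩ x hx
    refine ⟨T, hT, u, _, hu, aux_lift_sphere Hmat T u g hT hg x hx, ?_, rfl⟩
    simp only [hg0]
    exact congrArg (fun f : EuclideanSpace ℂ (Fin n) →L[ℂ] EuclideanSpace ℂ (Fin n) => f x)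
      (map_one (Matrix.toEuclideanCLM (n := Fin n) (𝕜 := ℂ)))
  -- some Hamiltonian is not scalar
  have hns : ∃ v ∈ U, ∀ c : ℂ, (-Complex.I) • Hmat v ≠ c • (1 : Matrix (Fin n) (Fin n) ℂ) := by
    by_contra hcon
    push Not at hcon
    let e0 : EuclideanSpace ℂ (Fin n) := EuclideanSpace.single ⟨0, by omega⟩ 1
    let e1 : EuclideanSpace ℂ (Fin n) := EuclideanSpace.single ⟨1, by omega⟩ 1
    have he0 : ‖e0‖ = 1 := by simp [e0]
    have he1 : ‖e1‖ = 1 := by simp [e1]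
    have h01 : inner ℂ e1 e0 = 0 := by simp [e0, e1, EuclideanSpace.inner_single_left]
    have hRz : ∀ r ∈ R, inner ℂ e1 (Matrix.toEuclideanLin r e0) = 0 := by
      intro r hr
      obtain ⟨T, hT, u, ψ, hu, hψ, hψ0, hψT⟩ := hact r hr e0 he0
      rw [← hψT]
      exact aux_scalar U Hmat hcon T hT u hu.2.1 ψ hψ e1 (by rw [hψ0, h01])
    obtain ⟨g, hg, hge⟩ := hGtrans e0 (by simpa using he0) e1 (by simpa using he1)
    have hcl : IsClosed {g : Matrix (Fin n) (Fin n) ℂ | inner ℂ e1 (auxEv e0 g) = 0} :=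
      isClosed_eq (by fun_prop) continuous_const
    have h2 : inner ℂ e1 (auxEv e0 g) = 0 := closure_minimal hRz hcl (hdense hg)
    rw [auxEv_apply, hge, inner_self_eq_zero] at h2
    rw [h2, norm_zero] at he1
    exact zero_ne_one he1
  set Λ := Matrix.toEuclideanCLM (n := Fin n) (𝕜 := ℂ) with hΛ
  have hΛc : Continuous Λ :=
    LinearMap.continuous_of_finiteDimensional
      (Λ.toAlgEquiv.toLinearMap : Matrix (Fin n) (Fin n) ℂ →ₗ[ℂ] _)
  obtain ⟨r, ⟨a, ha, rfl⟩, hr⟩ := aux_main' (Λ '' R)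
    {X | ∃ v ∈ U, X = Λ ((-Complex.I) • Hmat v)} (Λ '' G)
    (by
      rintro _ ⟨a, ha, rfl⟩ _ ⟨b, hb, rfl⟩
      exact ⟨a * b, aux_lifted_mul U Hmat a b ha hb, map_mul _ _ _⟩)
    (by
      rintro _ ⟨v, hv, rfl⟩ t ht
      obtain ⟨g, hg, h⟩ := aux_lifted_exp U Hmat v hv (hherm v hv) t ht
      exact ⟨g, hg, h⟩)
    (by
      rintro _ ⟨v, hv, rfl⟩
      rw [← map_star, ← map_neg]
      congr 1
      rw [star_smul, Matrix.star_eq_conjTranspose, (hherm v hv).eq]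
      simp)
    (Set.image_mono hsub)
    (by
      rintro _ ⟨g, hg, rfl⟩
      exact image_closure_subset_closure_image hΛc ⟨g, hdense hg, rfl⟩)
    (by
      rintro _ ⟨g, hg, rfl⟩
      exact Unitary.mem_iff.1 ((aux_map_unitary g).1 (hGU hg)))
    (by
      rintro _ ⟨g, hg, rfl⟩
      exact ⟨star g, hGinv g hg, map_star _ _⟩)
    (by
      intro z w hz hw
      obtain ⟨g, hg, h⟩ := hGtrans z (by simpa using hz) w (by simpa using hw)
      exact ⟨Λ g, ⟨g, hg, rfl⟩, h⟩)
    (by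
      obtain ⟨v, hv, h⟩ := hns
      refine ⟨_, ⟨v, hv, rfl⟩, fun c hc => h c ?_⟩
      apply Λ.injective
      change Λ _ = Λ _
      rw [hc, map_smul, map_one])
    ψ0 ψ1 hψ0' hψ1'
  rw [← hr]
  exact hact a ha ψ0 hψ0'
end
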